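/- arXiv:2105.12611 — 8 statements merged into one kernel-verified Lean document; each statement's English description precedes it below -/
import Mathlib

section
/- The function h(t) := 2t − √(4t² − 2t ln t), defined for t ≥ 1, satisfies: (a) h(t) − (1/2) ln t → 0 as t → +∞; and (b) h is differentiable with h'(t) > 0 for every t > 1. -/
open Real Filter Set

theorem four_mul_sq_sub_pos {t : ℝ} (ht : 1 ≤ t) : 0 < 4 * t ^ 2 - 2 * t * Real.log t := by
  have := Real.log_le_sub_one_of_pos (zero_lt_one.trans_le ht)
  nlinarith

theorem log_add_one_sq_lt {t : ℝ} (ht : 1 ≤ t) : (Real.log t + 1) ^ 2 < 8 * t := by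
  have h0 : 0 < t := zero_lt_one.trans_le ht
  have hlog := Real.log_le_sub_one_of_pos (Real.sqrt_pos.2 h0)
  rw [Real.log_sqrt h0.le] at hlog
  have hlog0 := Real.log_nonneg ht
  nlinarith [Real.sq_sqrt h0.le, Real.sqrt_nonneg t]

/-- The shift differs from `(1/2) ln t` by at most `(ln t)² / (4t)`. -/
theorem shift_sub_half_log_mem_Icc {t : ℝ} (ht : 1 ≤ t) :
    2 * t - √(4 * t ^ 2 - 2 * t * Real.log t) - (1 / 2) * Real.log t ∈
      Icc 0 (Real.log t ^ 2 / (4 * t)) := by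
  have h0 : 0 < t := zero_lt_one.trans_le ht
  have hlog := Real.log_le_sub_one_of_pos h0
  have hlog0 := Real.log_nonneg ht
  have hsq := Real.sq_sqrt (four_mul_sq_sub_pos ht).le
  have hlower : 2 * t - Real.log t ≤ √(4 * t ^ 2 - 2 * t * Real.log t) :=
    Real.le_sqrt_of_sq_le (by nlinarith)
  have hupper : √(4 * t ^ 2 - 2 * t * Real.log t) ≤ 2 * t :=
    Real.sqrt_le_iff.2 ⟨by positivity, by nlinarith⟩
  set s := √(4 * t ^ 2 - 2 * t * Real.log t)
  have heq : 2 * t - s - (1 / 2) * Real.log t = (2 * t - s) ^ 2 / (4 * t) := by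
    field_simp
    nlinarith
  rw [heq]
  refine ⟨by positivity, ?_⟩
  gcongr
  linarith

theorem hasDerivAt_shift {t : ℝ} (ht : 1 ≤ t) :
    HasDerivAt (fun t => 2 * t - √(4 * t ^ 2 - 2 * t * Real.log t))
      (2 - (4 * t - Real.log t - 1) / √(4 * t ^ 2 - 2 * t * Real.log t)) t := by
  have h0 : t ≠ 0 := (zero_lt_one.trans_le ht).ne'
  have hpos := four_mul_sq_sub_pos ht
  have hlin : HasDerivAt (fun t : ℝ => 2 * t) 2 t := by
    simpa using (hasDerivAt_id t).const_mul 2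
  have hrad : HasDerivAt (fun t => 4 * t ^ 2 - 2 * t * Real.log t)
      (2 * (4 * t - Real.log t - 1)) t := by
    refine (((hasDerivAt_pow 2 t).const_mul 4).sub
      (hlin.mul (Real.hasDerivAt_log h0))).congr_deriv ?_
    field_simp
    push_cast
    ring
  refine (hlin.sub (hrad.sqrt hpos.ne')).congr_deriv ?_
  rw [mul_div_mul_left _ _ two_ne_zero]

/-- `h(t) = 2t − √(4t² − 2t ln t)` satisfies
`h(t) − (1/2) ln t → 0` as `t → +∞`, and `h` is differentiable with `h' > 0`
on `(1,∞)`. -/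
theorem statement_3 (h : ℝ → ℝ)
    (hh : ∀ t, h t = 2 * t - Real.sqrt (4 * t ^ 2 - 2 * t * Real.log t)) :
    Tendsto (fun t => h t - (1 / 2) * Real.log t) atTop (nhds 0) ∧
    ∀ t > (1:ℝ), DifferentiableAt ℝ h t ∧ 0 < deriv h t := by
  obtain rfl : h = fun t => 2 * t - √(4 * t ^ 2 - 2 * t * Real.log t) := funext hh
  constructor
  · have hlim : Tendsto (fun t => Real.log t ^ 2 / (4 * t)) atTop (nhds 0) := by
      simpa using Real.tendsto_pow_log_div_mul_add_atTop 4 0 2 four_ne_zero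
    refine squeeze_zero' ?_ ?_ hlim
    · filter_upwards [eventually_ge_atTop 1] with t ht using (shift_sub_half_log_mem_Icc ht).1
    · filter_upwards [eventually_ge_atTop 1] with t ht using (shift_sub_half_log_mem_Icc ht).2
  · intro t ht
    have hderiv := hasDerivAt_shift ht.le
    refine ⟨hderiv.differentiableAt, ?_⟩
    have hpos := four_mul_sq_sub_pos ht.le
    rw [hderiv.deriv, sub_pos, div_lt_iff₀ (Real.sqrt_pos.2 hpos)]
    refine lt_of_pow_lt_pow_left₀ 2 (by positivity) ?_
    rw [mul_pow, Real.sq_sqrt hpos.le]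
    linarith [log_add_one_sq_lt ht.le]
end

section
/- Fix δ > 0, let U₀(t,x) := δ (e^t/√t) e^{-x²/(4t)} and h(t) := 2t − √(4t² − 2t ln t). Then for every t > 1 one has the identity ∂_x U₀(t, 2t − h(t)) = −δ + (h(t)/(2t)) δ, and in particular ∂_x U₀(t, 2t − h(t)) > −δ. Consequently, if moreover U_* satisfies U_*(z) = δ e^{-z} for all z ≥ 0 (so that U_*(0) = δ = U₀(t, 2t−h(t)) and U_*'(0) = −δ), then at the junction point x = 2t − h(t) the left profile U_*(x − 2t + h(t)) and the right profile U₀(t,x) meet continuously with strictly smaller left derivative: U_*'(0) < ∂_x U₀(t, 2t − h(t)). -/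
open Real Filter Set

/-- The heat-type profile `a e^{-x²/(4t)}` has spatial derivative `-(x/(2t))` times itself. -/
theorem hasDerivAt_const_mul_exp_neg_sq_div (a t x : ℝ) :
    HasDerivAt (fun y => a * Real.exp (-y ^ 2 / (4 * t)))
      (-(x / (2 * t)) * (a * Real.exp (-x ^ 2 / (4 * t)))) x := by
  have h := ((((hasDerivAt_id' x).pow 2).neg.div_const (4 * t)).exp).const_mul a
  refine h.congr_deriv ?_
  rcases eq_or_ne t 0 with rfl | ht
  · simp
  · simp only [Pi.pow_apply, Pi.neg_apply]
    field_simp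
    norm_num
    ring

theorem four_mul_sq_sub_two_mul_mul_log_nonneg {t : ℝ} (ht : 0 < t) :
    0 ≤ 4 * t ^ 2 - 2 * t * Real.log t := by
  have hlog := Real.log_le_sub_one_of_pos ht
  nlinarith [mul_le_mul_of_nonneg_left hlog ht.le]

/-- The level set `x² = 4t² - 2t log t` is where `(e^t/√t) e^{-x²/(4t)}` equals `1`. -/
theorem exp_div_sqrt_mul_exp_neg_sq_div_eq_one {t x : ℝ} (ht : 0 < t)
    (hx : x ^ 2 = 4 * t ^ 2 - 2 * t * Real.log t) :
    Real.exp t / Real.sqrt t * Real.exp (-x ^ 2 / (4 * t)) = 1 := by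
  have hexp : -x ^ 2 / (4 * t) = Real.log t / 2 - t := by
    rw [hx]
    field_simp
    ring
  have hsqrt : Real.exp (Real.log t / 2) = Real.sqrt t := by
    rw [Real.exp_half, Real.exp_log ht]
  have hpos : 0 < Real.sqrt t := Real.sqrt_pos.2 ht
  rw [hexp, Real.exp_sub, hsqrt]
  field_simp

/-- the angle condition at the junction point `x = 2t − h(t)`:
`∂_x U₀(t, 2t−h(t)) = −δ + (h(t)/(2t)) δ > −δ`, and if `U_*(z) = δe^{-z}` for
`z ≥ 0` (so `U_*'(0) = −δ`) then `U_*'(0) < ∂_x U₀(t, 2t−h(t))`. -/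
theorem statement_4 (δ : ℝ) (hδ : 0 < δ)
    (U₀ : ℝ → ℝ → ℝ)
    (hU₀ : ∀ t x : ℝ,
      U₀ t x = δ * (Real.exp t / Real.sqrt t) * Real.exp (-x ^ 2 / (4 * t)))
    (h : ℝ → ℝ)
    (hh : ∀ t, h t = 2 * t - Real.sqrt (4 * t ^ 2 - 2 * t * Real.log t)) :
    ∀ t > (1:ℝ),
      (deriv (fun x => U₀ t x) (2 * t - h t) = -δ + h t / (2 * t) * δ ∧
        -δ < deriv (fun x => U₀ t x) (2 * t - h t)) ∧
      (∀ Ustar : ℝ → ℝ,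
        (∀ z ≥ (0:ℝ), Ustar z = δ * Real.exp (-z)) →
        deriv Ustar 0 = -δ →
        deriv Ustar 0 < deriv (fun x => U₀ t x) (2 * t - h t)) := by
  intro t ht
  have ht0 : 0 < t := by linarith
  have hsq : (2 * t - h t) ^ 2 = 4 * t ^ 2 - 2 * t * Real.log t := by
    rw [hh, sub_sub_cancel, Real.sq_sqrt (four_mul_sq_sub_two_mul_mul_log_nonneg ht0)]
  have hpos : 0 < h t := by
    have hlog : 0 < t * Real.log t := mul_pos ht0 (Real.log_pos ht)
    rw [hh, sub_pos, Real.sqrt_lt' (by linarith)]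
    linarith
  have hderiv : deriv (fun x => U₀ t x) (2 * t - h t) = -δ + h t / (2 * t) * δ := by
    simp only [hU₀]
    rw [(hasDerivAt_const_mul_exp_neg_sq_div _ t _).deriv, mul_assoc δ,
      exp_div_sqrt_mul_exp_neg_sq_div_eq_one ht0 hsq]
    field_simp
    ring
  have hlt : -δ < deriv (fun x => U₀ t x) (2 * t - h t) := by
    rw [hderiv]
    exact lt_add_of_pos_right _ (by positivity)
  exact ⟨⟨hderiv, hlt⟩, fun Ustar _ hUstar => hUstar ▸ hlt⟩
end

section
/- Assume f is C² monostable, normalized with f'(0)=1, with decreasing minimal wave U_* of speed 2. Let r > 0 and let h : (0,∞) → ℝ be C¹ with h(t) = O(1) and h'(t) = o(1/t) as t→+∞. Then there exist a nontrivial, nonincreasing C² function χ with support contained in (−∞,0) and χ(−∞) = 1, and a time T > 0, such that the function u̲₁(t,x) := U_*(x − 2t + r ln t − h(t)) − χ(x − 2t + r ln t − h(t)) e^{(f'(1)/2) t} satisfies ∂_t u̲₁ − ∂_xx u̲₁ − f(u̲₁) ≤ 0 for all t ≥ T and x ∈ ℝ. -/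
open Real Filter Set

/-- A smooth nonincreasing cutoff equal to `1` left of `a` and to `0` right of `b`. -/
lemma exists_antitone_cutoff {a b : ℝ} (hab : a < b) :
    ∃ χ : ℝ → ℝ, ContDiff ℝ 2 χ ∧ Antitone χ ∧ (∀ y ≤ a, χ y = 1) ∧ (∀ y, b ≤ y → χ y = 0) ∧
      (∀ y, 0 ≤ χ y) ∧ (∀ y, χ y ≤ 1) := by
  have hd : 0 < b - a := sub_pos.2 hab
  refine ⟨fun y => Real.smoothTransition ((b - y) / (b - a)), ?_, ?_, ?_, ?_, ?_, ?_⟩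
  · exact (Real.smoothTransition.contDiff (n := 2)).comp (by fun_prop)
  · intro x y hxy
    apply Real.smoothTransition.monotone
    gcongr
  · intro y hy
    apply Real.smoothTransition.one_of_one_le
    rw [one_le_div hd]
    linarith
  · intro y hy
    apply Real.smoothTransition.zero_of_nonpos
    exact div_nonpos_of_nonpos_of_nonneg (by linarith) hd.le
  · exact fun y => Real.smoothTransition.nonneg _
  · exact fun y => Real.smoothTransition.le_one _

/-- The first two derivatives of a `C²` function that is constant on each side of `[a, b]` vanish
off `[a, b]` and are bounded on it. -/
lemma exists_bound_deriv_of_const_sides {χ : ℝ → ℝ} {a b c d : ℝ} (hχ : ContDiff ℝ 2 χ)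
    (ha : ∀ y ≤ a, χ y = c) (hb : ∀ y, b ≤ y → χ y = d) :
    (∀ y ∉ Icc a b, deriv χ y = 0 ∧ deriv (deriv χ) y = 0) ∧
      ∃ C, 0 ≤ C ∧ ∀ y ∈ Icc a b, |deriv χ y| ≤ C ∧ |deriv (deriv χ) y| ≤ C := by
  have h1 : ContDiff ℝ 1 (deriv χ) := ((contDiff_succ_iff_deriv (n := 1)).1 hχ).2.2
  have h2 : Continuous (deriv (deriv χ)) := h1.continuous_deriv le_rfl
  constructor
  · intro y hy
    have key : ∀ c, χ =ᶠ[nhds y] (fun _ => c) → deriv χ y = 0 ∧ deriv (deriv χ) y = 0 := by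
      intro c hc
      have h3 : deriv χ =ᶠ[nhds y] fun _ => 0 := by
        simpa using hc.deriv
      exact ⟨h3.eq_of_nhds, by simpa using h3.deriv_eq⟩
    rcases lt_or_ge y a with h | h
    · exact key c (by filter_upwards [Iio_mem_nhds h] with z hz using ha z (le_of_lt hz))
    · have hby : b < y := by
        by_contra! hn
        exact hy ⟨h, hn⟩
      exact key d (by filter_upwards [Ioi_mem_nhds hby] with z hz using hb z (le_of_lt hz))
  · obtain ⟨C₁, hC₁⟩ := isCompact_Icc.exists_bound_of_continuousOn (s := Icc a b)
      h1.continuous.continuousOn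
    obtain ⟨C₂, hC₂⟩ := isCompact_Icc.exists_bound_of_continuousOn (s := Icc a b)
      h2.continuousOn
    refine ⟨max 0 (max C₁ C₂), le_max_left _ _, fun y hy => ⟨?_, ?_⟩⟩
    · exact (hC₁ y hy).trans ((le_max_left _ _).trans (le_max_right _ _))
    · exact (hC₂ y hy).trans ((le_max_right _ _).trans (le_max_right _ _))

/-- A decreasing solution of the wave equation has negative derivative. -/
lemma deriv_neg_of_wave {f U : ℝ → ℝ} (hU : Antitone U) (hpos : ∀ z, 0 < f (U z))
    (hode : ∀ z, deriv (deriv U) z + 2 * deriv U z + f (U z) = 0) (z : ℝ) : deriv U z < 0 := by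
  refine lt_of_le_of_ne hU.deriv_nonpos fun h0 => ?_
  have hmax : IsLocalMax (deriv U) z := Eventually.of_forall fun y => by
    rw [h0]
    exact hU.deriv_nonpos
  have := hode z
  rw [hmax.deriv_eq_zero, h0] at this
  linarith [hpos z]

/-- Arbitrarily far to the left there is an interval on which `U'` is bounded away from `0`. -/
lemma exists_interval_deriv_le_neg {f U : ℝ → ℝ} (hf : Differentiable ℝ f)
    (hU : Differentiable ℝ U) (hneg : ∀ z, deriv U z < 0)
    (hode : ∀ z, deriv (deriv U) z + 2 * deriv U z + f (U z) = 0) (m : ℝ) :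
    ∃ a b k : ℝ, a < b ∧ b < m ∧ 0 < k ∧ ∀ z ∈ Icc a b, deriv U z ≤ -k := by
  obtain ⟨z, hzm, hz⟩ : ∃ z < m, DifferentiableAt ℝ (deriv U) z := by
    by_contra! hn
    have heq : ∀ z < m, deriv U z = -(f (U z)) / 2 := fun z hz => by
      have := hode z
      rw [deriv_zero_of_not_differentiableAt (hn z hz)] at this
      linarith
    refine hn (m - 1) (by linarith) ?_
    have hd : DifferentiableAt ℝ (fun z => -(f (U z)) / 2) (m - 1) :=
      (((hf _).comp _ (hU _)).neg).div_const 2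
    refine hd.congr_of_eventuallyEq ?_
    filter_upwards [Iio_mem_nhds (show m - 1 < m by linarith)] with z hz using heq z hz
  have hev : ∀ᶠ y in nhds z, deriv U y < deriv U z / 2 ∧ y < m :=
    (hz.continuousAt.eventually_lt_const (by linarith [hneg z])).and (Iio_mem_nhds hzm)
  obtain ⟨ε, hε, hball⟩ := Metric.eventually_nhds_iff.1 hev
  have hin : ∀ y ∈ Icc (z - ε / 2) (z + ε / 2), deriv U y < deriv U z / 2 ∧ y < m := by
    intro y hy
    apply hball
    rw [Real.dist_eq, abs_lt]
    constructor <;> linarith [hy.1, hy.2]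
  refine ⟨z - ε / 2, z + ε / 2, -(deriv U z / 2), by linarith, ?_, by linarith [hneg z], ?_⟩
  · exact (hin _ ⟨by linarith, le_rfl⟩).2
  · intro y hy
    linarith [(hin y hy).1]

/-- If `f'(p) < 0`, then `f` decreases at rate at least `|f'(p)| / 2` near `p`. -/
lemma exists_sub_le_of_deriv_neg {f : ℝ → ℝ} (hf : ContDiff ℝ 2 f) {p : ℝ}
    (hp : deriv f p < 0) :
    ∃ δ > 0, ∀ x y, p - δ < x → x ≤ y → y < p + δ → f y - f x ≤ deriv f p / 2 * (y - x) := by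
  have hc : Continuous (deriv f) := hf.continuous_deriv (by norm_num)
  have hev : ∀ᶠ s in nhds p, deriv f s < deriv f p / 2 :=
    hc.continuousAt.eventually_lt_const (by linarith)
  obtain ⟨δ, hδ, hball⟩ := Metric.eventually_nhds_iff.1 hev
  refine ⟨δ, hδ, fun x y hx hxy hy => ?_⟩
  have hd : Differentiable ℝ f := hf.differentiable (by norm_num)
  refine (convex_Ioo (p - δ) (p + δ)).image_sub_le_mul_sub_of_deriv_le
    hd.continuous.continuousOn hd.differentiableOn (fun s hs => ?_) x
    ⟨hx, by linarith⟩ y ⟨by linarith, hy⟩ hxy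
  rw [interior_Ioo] at hs
  refine (hball ?_).le
  rw [Real.dist_eq, abs_lt]
  constructor <;> linarith [hs.1, hs.2]

/-- The derivative of a difference with a differentiable function, allowing the first function to
be non-differentiable (in which case both its derivative and that of the difference are `0`). -/
lemma deriv_sub_abs_le_deriv_sub {V g : ℝ → ℝ} {z : ℝ} (hg : DifferentiableAt ℝ g z) :
    deriv V z - |deriv g z| ≤ deriv (fun y => V y - g y) z := by
  by_cases hV : DifferentiableAt ℝ V z
  · rw [deriv_fun_sub hV hg]
    linarith [le_abs_self (deriv g z)]
  · have hn : ¬ DifferentiableAt ℝ (fun y => V y - g y) z := fun hd => hV <| by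
      simpa using hd.fun_add hg
    rw [deriv_zero_of_not_differentiableAt hV, deriv_zero_of_not_differentiableAt hn]
    linarith [abs_nonneg (deriv g z)]

/-- Lemma 4.2: the shifted wave, corrected by a cutoff times
an exponentially decaying term, is a subsolution. -/
theorem statement_6
    (f : ℝ → ℝ) (hf : ContDiff ℝ 2 f)
    (hf0 : f 0 = 0) (hf1 : f 1 = 0)
    (hf'0 : deriv f 0 = 1) (hf'1 : deriv f 1 < 0)
    (hfpos : ∀ s ∈ Set.Ioo (0:ℝ) 1, 0 < f s)
    (Ustar : ℝ → ℝ)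
    (hUstar_anti : StrictAnti Ustar)
    (hUstar_ode : ∀ z,
      deriv (deriv Ustar) z + 2 * deriv Ustar z + f (Ustar z) = 0)
    (hUstar_limbot : Tendsto Ustar atBot (nhds 1))
    (hUstar_limtop : Tendsto Ustar atTop (nhds 0))
    (r : ℝ) (hr : 0 < r)
    (h : ℝ → ℝ) (hhC1 : ContDiff ℝ 1 h)
    (hhO : h =O[atTop] (fun _ => (1:ℝ)))
    (hh' : deriv h =o[atTop] fun t => 1 / t) :
    ∃ (χ : ℝ → ℝ) (T : ℝ), 0 < T ∧
      ContDiff ℝ 2 χ ∧ Antitone χ ∧ (∃ y, χ y ≠ 0) ∧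
      Function.support χ ⊆ Set.Iio 0 ∧ Tendsto χ atBot (nhds 1) ∧
      ∀ u1 : ℝ → ℝ → ℝ,
        (∀ t x : ℝ, u1 t x =
          Ustar (x - 2 * t + r * Real.log t - h t)
            - χ (x - 2 * t + r * Real.log t - h t)
              * Real.exp (deriv f 1 / 2 * t)) →
        ∀ t ≥ T, ∀ x : ℝ,
          deriv (fun s => u1 s x) t - deriv (deriv (fun y => u1 t y)) x
            - f (u1 t x) ≤ 0 := by
  have hlim_gt : ∀ z, 0 < Ustar z := fun z =>
    (hUstar_anti.antitone.le_of_tendsto hUstar_limtop (z + 1)).trans_lt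
      (hUstar_anti (by linarith))
  have hlim_lt : ∀ z, Ustar z < 1 := fun z =>
    (hUstar_anti (show z - 1 < z by linarith)).trans_le
      (hUstar_anti.antitone.ge_of_tendsto hUstar_limbot (z - 1))
  have hneg : ∀ z, deriv Ustar z < 0 := deriv_neg_of_wave hUstar_anti.antitone
    (fun z => hfpos _ ⟨hlim_gt z, hlim_lt z⟩) hUstar_ode
  have hUd : Differentiable ℝ Ustar := fun z =>
    differentiableAt_of_deriv_ne_zero (hneg z).ne
  obtain ⟨δ, hδ, hfδ⟩ := exists_sub_le_of_deriv_neg hf hf'1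
  obtain ⟨m, hm⟩ := eventually_atBot.1
    (hUstar_limbot.eventually_const_lt (show 1 - δ / 2 < 1 by linarith))
  obtain ⟨a, b, k, hab, hbm, hk, hVk⟩ := exists_interval_deriv_le_neg
    (hf.differentiable (by norm_num)) hUd hneg hUstar_ode (min m 0)
  obtain ⟨χ, hχ, hχanti, hχa, hχb, hχ0, hχ1⟩ := exists_antitone_cutoff hab
  obtain ⟨hoff, C, hC, hon⟩ := exists_bound_deriv_of_const_sides hχ hχa hχb
  have hχd : Differentiable ℝ χ := hχ.differentiable (by norm_num)
  have hχdd : Differentiable ℝ (deriv χ) :=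
    (((contDiff_succ_iff_deriv (n := 1)).1 hχ).2.2).differentiable (by norm_num)
  have hexp : Tendsto (fun t : ℝ => t * Real.exp (deriv f 1 / 2 * t)) atTop (nhds 0) := by
    have := tendsto_rpow_mul_exp_neg_mul_atTop_nhds_zero 1 (-(deriv f 1 / 2)) (by linarith)
    simpa using this
  have hev1 : ∀ᶠ t : ℝ in atTop,
      (3 + 2 * r) * C * (t * Real.exp (deriv f 1 / 2 * t)) < r * k / 2 := by
    have := hexp.const_mul ((3 + 2 * r) * C)
    rw [mul_zero] at this
    exact this.eventually_lt_const (by positivity)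
  have hev2 : ∀ᶠ t : ℝ in atTop, t * Real.exp (deriv f 1 / 2 * t) < δ / 2 :=
    hexp.eventually_lt_const (by positivity)
  have hev3 : ∀ᶠ t : ℝ in atTop, ‖deriv h t‖ ≤ r / 2 * ‖1 / t‖ :=
    hh'.def (by positivity)
  obtain ⟨T, hT⟩ := eventually_atTop.1 (hev1.and (hev2.and (hev3.and (eventually_ge_atTop 1))))
  refine ⟨χ, max T 1, by positivity, hχ, hχanti, ⟨a, by simp [hχa a le_rfl]⟩, ?_, ?_, ?_⟩
  · intro y hy
    by_contra hn
    have hy0 : (0 : ℝ) ≤ y := not_lt.1 hn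
    exact hy (hχb y (by linarith [min_le_right m 0]))
  · refine tendsto_const_nhds.congr' ?_
    filter_upwards [eventually_le_atBot a] with y hy using (hχa y hy).symm
  intro u1 hu1 t ht x
  obtain ⟨hT1, hT2, hT3, ht1⟩ := hT t ((le_max_left _ _).trans ht)
  have ht0 : 0 < t := by linarith
  set e := Real.exp (deriv f 1 / 2 * t) with he
  have he0 : 0 < e := Real.exp_pos _
  set z := x - 2 * t + r * Real.log t - h t with hz
  set s := r / t - deriv h t with hs
  have htime : deriv (fun τ => u1 τ x) t =
      (-2 + s) * (deriv Ustar z - deriv χ z * e) - χ z * (e * (deriv f 1 / 2)) := by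
    have hζ : HasDerivAt (fun τ => x - 2 * τ + r * Real.log τ - h τ) (-2 + s) t := by
      have h1 := (((hasDerivAt_id t).const_mul 2).const_sub x).add
        ((Real.hasDerivAt_log ht0.ne').const_mul r)
      have h2 := h1.sub ((hhC1.differentiable (by norm_num)) t).hasDerivAt
      refine h2.congr_deriv ?_
      rw [hs]
      ring
    have hE : HasDerivAt (fun τ => Real.exp (deriv f 1 / 2 * τ)) (e * (deriv f 1 / 2)) t := by
      simpa using ((hasDerivAt_id t).const_mul (deriv f 1 / 2)).exp
    have hUc := (hUd z).hasDerivAt.comp t hζ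
    have hχc := (hχd z).hasDerivAt.comp t hζ
    have hall := hUc.sub (hχc.mul hE)
    simp only [hu1]
    refine (hall.congr_deriv ?_).deriv
    simp only [Function.comp_apply, ← hz, ← he]
    ring
  have hspace : deriv (deriv (fun y => u1 t y)) x =
      deriv (fun y => deriv Ustar y - deriv χ y * e) z := by
    have hc : ∀ y, y - 2 * t + r * Real.log t - h t = y + (z - x) := fun y => by
      rw [hz]
      ring
    have h1 : (fun y => u1 t y) =
        fun y => (fun w => Ustar w - χ w * e) (y + (z - x)) := by
      funext y
      simp only [hu1, hc, he]
    have h2 : deriv (fun w => Ustar w - χ w * e) = fun w => deriv Ustar w - deriv χ w * e := by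
      funext w
      rw [deriv_fun_sub (hUd w) ((hχd w).mul_const e), deriv_mul_const (hχd w)]
    have h3 : deriv (fun y => u1 t y) =
        fun y => (fun w => deriv Ustar w - deriv χ w * e) (y + (z - x)) := by
      funext y
      rw [h1, deriv_comp_add_const (fun w => Ustar w - χ w * e), h2]
    rw [h3, deriv_comp_add_const (fun w => deriv Ustar w - deriv χ w * e), add_sub_cancel]
  have hD : deriv (deriv Ustar) z - |deriv (deriv χ) z| * e ≤
      deriv (fun y => deriv Ustar y - deriv χ y * e) z := by
    have := deriv_sub_abs_le_deriv_sub (V := deriv Ustar) (hχdd z |>.mul_const e)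
    rwa [deriv_mul_const (hχdd z), abs_mul, abs_of_pos he0] at this
  have hreact : f (Ustar z) - f (Ustar z - χ z * e) ≤ deriv f 1 / 2 * (χ z * e) := by
    rcases le_or_gt b z with hbz | hbz
    · simp [hχb z hbz]
    · have hUz := hm z (by linarith [min_le_left m 0])
      have hχe : χ z * e < δ / 2 := by nlinarith [hχ1 z]
      have hχe0 : 0 ≤ χ z * e := mul_nonneg (hχ0 z) he0.le
      have := hfδ (Ustar z - χ z * e) (Ustar z) (by linarith) (by linarith)
        (by linarith [hlim_lt z])
      rwa [sub_sub_cancel] at this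
  rw [Real.norm_eq_abs, Real.norm_eq_abs, abs_of_pos (by positivity : 0 < 1 / t)] at hT3
  have hs_lo : r / 2 * (1 / t) ≤ s := by
    have : r / t = r * (1 / t) := by ring
    linarith [le_abs_self (deriv h t)]
  have hs_hi : s ≤ 2 * r := by
    have h1 : r / t = r * (1 / t) := by ring
    have h2 : r * (1 / t) ≤ r := mul_le_of_le_one_right hr.le ((div_le_one ht0).2 ht1)
    linarith [neg_abs_le (deriv h t)]
  have hs0 : 0 < s := lt_of_lt_of_le (by positivity) hs_lo
  have hcut : s * deriv Ustar z - (-2 + s) * (deriv χ z * e) +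
      |deriv (deriv χ) z| * e ≤ 0 := by
    by_cases hzI : z ∈ Icc a b
    · obtain ⟨hc1, hc2⟩ := hon z hzI
      have h1 : s * deriv Ustar z ≤ -(r / 2 * (1 / t) * k) := by
        nlinarith [hVk z hzI]
      have h2 : -((-2 + s) * (deriv χ z * e)) ≤ (2 + 2 * r) * (C * e) := by
        refine (neg_le_abs _).trans ?_
        rw [abs_mul, abs_mul, abs_of_pos he0]
        gcongr
        rw [abs_le]
        constructor <;> linarith
      have h3 : |deriv (deriv χ) z| * e ≤ C * e := by gcongr
      have h4 : (3 + 2 * r) * C * e ≤ r / 2 * (1 / t) * k := by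
        have : r / 2 * (1 / t) * k = r * k / 2 / t := by ring
        rw [this, le_div_iff₀ ht0]
        linarith
      linarith
    · obtain ⟨hc1, hc2⟩ := hoff z hzI
      simp only [hc1, hc2, abs_zero, zero_mul, mul_zero, sub_zero, add_zero]
      exact (mul_neg_of_pos_of_neg hs0 (hneg z)).le
  rw [htime, hspace, hu1 t x]
  linarith [hUstar_ode z]
end

section
/- Assume f is C² monostable with f'(0)=1 and ‖f''‖_∞ < ∞. For any ε ∈ (0,1/2) there exist C > 0 and T > 0 such that the function u̲₂(t,x) := (1 + C/√t) · [ t^{−ε} + (x − 2t + (1/2) ln t)/t ] · e^{−(x − 2t + (1/2) ln t)} · e^{−(x − 2t + (1/2) ln t)²/(4t)} satisfies ∂_t u̲₂ − ∂_xx u̲₂ − f(u̲₂) ≤ 0 for all t ≥ T and all x ≥ 2t + ln t − 2. -/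
open Real Filter Set

/-- A `C²` function with `f 0 = 0`, `f' 0 = 1` and `|f''| ≤ K` lies above the parabola
`u - K u²` on the positive half-line. -/
lemma sub_mul_sq_le_of_abs_deriv_deriv_le {f : ℝ → ℝ} (hf : ContDiff ℝ 2 f) (hf0 : f 0 = 0)
    (hf'0 : deriv f 0 = 1) {K : ℝ} (hK : ∀ u : ℝ, |deriv (deriv f) u| ≤ K) {u : ℝ} (hu : 0 ≤ u) :
    u - K * u ^ 2 ≤ f u := by
  have hK0 : 0 ≤ K := (abs_nonneg _).trans (hK 0)
  have hd : Differentiable ℝ f := hf.differentiable (by norm_num)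
  have hf2 : ContDiff ℝ (1 + 1) f := by simpa [one_add_one_eq_two] using hf
  have hd' : Differentiable ℝ (deriv f) :=
    (contDiff_succ_iff_deriv.1 hf2).2.2.differentiable (by norm_num)
  have hderiv : ∀ s : ℝ, |deriv f s - 1| ≤ K * |s| := by
    intro s
    have h := convex_univ.norm_image_sub_le_of_norm_deriv_le (f := deriv f) (C := K)
      (fun y _ => hd' y) (fun y _ => hK y) (mem_univ (0 : ℝ)) (mem_univ s)
    simpa [hf'0] using h
  have h := (convex_Icc 0 u).norm_image_sub_le_of_norm_hasDerivWithin_le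
    (f := fun s => f s - s) (f' := fun s => deriv f s - 1) (C := K * u)
    (fun y _ => ((hd y).hasDerivAt.sub (hasDerivAt_id y)).hasDerivWithinAt)
    (fun y hy => (hderiv y).trans (by
      rw [abs_of_nonneg hy.1]; exact mul_le_mul_of_nonneg_left hy.2 hK0))
    (left_mem_Icc.2 hu) (right_mem_Icc.2 hu)
  simp only [hf0, sub_zero, Real.norm_eq_abs, abs_of_nonneg hu] at h
  nlinarith [(abs_le.1 h).1]

/-- The time derivative of the right subsolution. -/
lemma hasDerivAt_rightSubsolution_time (C ε x : ℝ) {t : ℝ} (ht : 0 < t) :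
    HasDerivAt (fun s : ℝ => (1 + C / √s) * (s ^ (-ε) + (x - 2 * s + 1 / 2 * log s) / s)
        * exp (-(x - 2 * s + 1 / 2 * log s)) * exp (-(x - 2 * s + 1 / 2 * log s) ^ 2 / (4 * s)))
      (exp (-(x - 2 * t + 1 / 2 * log t)) * exp (-(x - 2 * t + 1 / 2 * log t) ^ 2 / (4 * t)) *
        (-(C / (2 * t * √t)) * (t ^ (-ε) + (x - 2 * t + 1 / 2 * log t) / t)
          + (1 + C / √t) * (-(ε * t ^ (-ε) / t) + (-2 + 1 / (2 * t)) / t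
            - (x - 2 * t + 1 / 2 * log t) / t ^ 2)
          + (1 + C / √t) * (t ^ (-ε) + (x - 2 * t + 1 / 2 * log t) / t) *
            ((-2 + 1 / (2 * t)) * (-1 - (x - 2 * t + 1 / 2 * log t) / (2 * t))
              + (x - 2 * t + 1 / 2 * log t) ^ 2 / (4 * t ^ 2)))) t := by
  have hs : 0 < √t := sqrt_pos.2 ht
  have hsq : √t ^ 2 = t := sq_sqrt ht.le
  have hz : HasDerivAt (fun s : ℝ => x - 2 * s + 1 / 2 * log s) (-2 + 1 / (2 * t)) t := by
    have h := (((hasDerivAt_id t).const_mul 2).const_sub x).add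
      ((hasDerivAt_log ht.ne').const_mul (1 / 2))
    refine h.congr_deriv ?_
    field_simp
  have hA : HasDerivAt (fun s : ℝ => 1 + C / √s) (-(C / (2 * t * √t))) t := by
    have h := (((hasDerivAt_const t C).div (hasDerivAt_sqrt ht.ne') hs.ne')).const_add 1
    refine h.congr_deriv ?_
    rw [hsq]
    field_simp
    ring
  have hr : HasDerivAt (fun s : ℝ => s ^ (-ε)) (-(ε * t ^ (-ε) / t)) t := by
    refine (hasDerivAt_rpow_const (p := -ε) (Or.inl ht.ne')).congr_deriv ?_
    rw [rpow_sub_one ht.ne']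
    ring
  have hB := hr.add (hz.div (hasDerivAt_id t) ht.ne')
  have hq := ((hz.pow 2).neg).div ((hasDerivAt_id t).const_mul 4) (by simpa using ht.ne')
  refine (((hA.mul hB).mul hz.neg.exp).mul hq.exp).congr_deriv ?_
  simp only [Pi.add_apply, Pi.mul_apply, Pi.div_apply, Pi.neg_apply, Pi.pow_apply, id]
  generalize x - 2 * t + 1 / 2 * log t = z
  generalize exp (-z) = E
  generalize exp (-z ^ 2 / (4 * t)) = G
  generalize t ^ (-ε) = r
  field_simp
  ring

/-- The first space derivative of the right subsolution, in a frame moved by `c`. -/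
lemma hasDerivAt_rightSubsolution_space (A r c : ℝ) {t : ℝ} (ht : 0 < t) (y : ℝ) :
    HasDerivAt (fun y : ℝ => A * (r + (y + c) / t) * exp (-(y + c))
        * exp (-(y + c) ^ 2 / (4 * t)))
      (A * (1 / t - (r + (y + c) / t) * (1 + (y + c) / (2 * t))) * exp (-(y + c))
        * exp (-(y + c) ^ 2 / (4 * t))) y := by
  have hz : HasDerivAt (fun y : ℝ => y + c) 1 y := (hasDerivAt_id y).add_const c
  have hB := ((hz.div_const t).const_add r).const_mul A
  have hq := ((hz.pow 2).neg).div_const (4 * t)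
  refine ((hB.mul hz.neg.exp).mul hq.exp).congr_deriv ?_
  simp only [Pi.mul_apply, Pi.neg_apply, Pi.pow_apply]
  generalize y + c = z
  generalize exp (-z) = E
  generalize exp (-z ^ 2 / (4 * t)) = G
  field_simp
  ring

/-- The second space derivative of the right subsolution, in a frame moved by `c`. -/
lemma hasDerivAt_deriv_rightSubsolution_space (A r c : ℝ) {t : ℝ} (ht : 0 < t) (y : ℝ) :
    HasDerivAt (fun y : ℝ => A * (1 / t - (r + (y + c) / t) * (1 + (y + c) / (2 * t)))
        * exp (-(y + c)) * exp (-(y + c) ^ 2 / (4 * t)))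
      (exp (-(y + c)) * exp (-(y + c) ^ 2 / (4 * t)) *
        (A * ((r + (y + c) / t) * ((1 + (y + c) / (2 * t)) ^ 2 - 1 / (2 * t))
          - 2 / t * (1 + (y + c) / (2 * t))))) y := by
  have hz : HasDerivAt (fun y : ℝ => y + c) 1 y := (hasDerivAt_id y).add_const c
  have hB := ((((hz.div_const t).const_add r).mul
    ((hz.div_const (2 * t)).const_add 1)).const_sub (1 / t)).const_mul A
  have hq := ((hz.pow 2).neg).div_const (4 * t)
  refine ((hB.mul hz.neg.exp).mul hq.exp).congr_deriv ?_
  simp only [Pi.mul_apply, Pi.neg_apply, Pi.pow_apply]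
  generalize y + c = z
  generalize exp (-z) = E
  generalize exp (-z ^ 2 / (4 * t)) = G
  field_simp
  ring

lemma mul_exp_neg_sq_div_four_le_one (y : ℝ) : y * exp (-(y ^ 2 / 4)) ≤ 1 := by
  rw [exp_neg, ← div_eq_mul_inv, div_le_one (exp_pos _)]
  nlinarith [add_one_le_exp (y ^ 2 / 4), sq_nonneg (y / 2 - 1)]

/-- Lemma 4.3: the explicit right subsolution `u̲₂` satisfies
the differential inequality for `t ≥ T` and `x ≥ 2t + ln t − 2`. -/
theorem statement_7
    (f : ℝ → ℝ) (hf : ContDiff ℝ 2 f)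
    (hf0 : f 0 = 0) (hf1 : f 1 = 0)
    (hf'0 : deriv f 0 = 1) (hf'1 : deriv f 1 < 0)
    (hfpos : ∀ s ∈ Set.Ioo (0:ℝ) 1, 0 < f s)
    (K : ℝ) (hK : ∀ u : ℝ, |deriv (deriv f) u| ≤ K) :
    ∀ ε ∈ Set.Ioo (0:ℝ) (1/2), ∃ C > (0:ℝ), ∃ T > (0:ℝ),
      ∀ u2 : ℝ → ℝ → ℝ,
        (∀ t x : ℝ, u2 t x =
          (1 + C / Real.sqrt t)
            * (t ^ (-ε) + (x - 2 * t + 1 / 2 * Real.log t) / t)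
            * Real.exp (-(x - 2 * t + 1 / 2 * Real.log t))
            * Real.exp (-(x - 2 * t + 1 / 2 * Real.log t) ^ 2 / (4 * t))) →
        ∀ t ≥ T, ∀ x ≥ 2 * t + Real.log t - 2,
          deriv (fun s => u2 s x) t - deriv (deriv (fun y => u2 t y)) x
            - f (u2 t x) ≤ 0 := by
  rintro ε ⟨hε0, hε1⟩
  have hK0 : 0 ≤ K := (abs_nonneg _).trans (hK 0)
  obtain ⟨C, hC⟩ : ∃ C, C = 16 * K * exp 2 + 1 := ⟨_, rfl⟩
  have hC0 : 0 < C := by rw [hC]; positivity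
  refine ⟨C, hC0, exp 2 + C ^ 2 + (1 / (2 * ε)) ^ 2, by positivity, ?_⟩
  intro u2 hu2 t ht x hx
  have hte : exp 2 ≤ t := by nlinarith [sq_nonneg C, sq_nonneg (1 / (2 * ε))]
  have hlog : 2 ≤ log t := by
    rw [← log_exp 2]; exact log_le_log (exp_pos 2) hte
  have ht0 : 0 < t := (exp_pos 2).trans_le hte
  have ht1 : 1 ≤ t := (one_le_exp (by norm_num)).trans hte
  have hs : 0 < √t := sqrt_pos.2 ht0
  have hsq : √t ^ 2 = t := sq_sqrt ht0.le
  have hs1 : 1 ≤ √t := one_le_sqrt.2 ht1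
  have hCs : C ≤ √t := le_sqrt_of_sq_le (by nlinarith [exp_pos 2, sq_nonneg (1 / (2 * ε))])
  have hεs : 1 / (2 * ε) ≤ √t := le_sqrt_of_sq_le (by nlinarith [exp_pos 2, sq_nonneg C])
  have hr1 : t ^ (-ε) ≤ 1 := rpow_le_one_of_one_le_of_nonpos ht1 (by linarith)
  have hrs : 1 ≤ t ^ (-ε) * √t := by
    rw [sqrt_eq_rpow, ← rpow_add ht0]
    exact one_le_rpow ht1 (by linarith)
  have hfun : (fun y => u2 t y) = fun y : ℝ => (1 + C / √t)
      * (t ^ (-ε) + (y + (-2 * t + 1 / 2 * log t)) / t)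
      * exp (-(y + (-2 * t + 1 / 2 * log t)))
      * exp (-(y + (-2 * t + 1 / 2 * log t)) ^ 2 / (4 * t)) := by
    funext y
    rw [hu2, show y - 2 * t + 1 / 2 * log t = y + (-2 * t + 1 / 2 * log t) by ring]
  have hxx := (hasDerivAt_deriv_rightSubsolution_space (1 + C / √t) (t ^ (-ε))
    (-2 * t + 1 / 2 * log t) ht0 x).deriv
  rw [← funext fun y => (hasDerivAt_rightSubsolution_space (1 + C / √t) (t ^ (-ε))
    (-2 * t + 1 / 2 * log t) ht0 y).deriv, ← hfun,
    show x + (-2 * t + 1 / 2 * log t) = x - 2 * t + 1 / 2 * log t by ring] at hxx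
  have htt := (hasDerivAt_rightSubsolution_time C ε x ht0).deriv
  rw [← funext fun s => hu2 s x] at htt
  have hz : 3 / 2 * log t - 2 ≤ x - 2 * t + 1 / 2 * log t := by linarith
  have hu := hu2 t x
  rw [hxx, htt]
  clear hxx htt
  generalize x - 2 * t + 1 / 2 * log t = z at *
  have hz0 : 0 ≤ z := by linarith
  have hE : exp (-z) ≤ exp 2 / (t * √t) := by
    have h : exp (3 / 2 * log t) = t * √t := by
      rw [show 3 / 2 * log t = log t + log t / 2 by ring, exp_add, exp_log ht0, exp_half,
        exp_log ht0]
    rw [← h, ← exp_sub]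
    exact exp_le_exp.2 (by linarith)
  have hG1 : exp (-z ^ 2 / (4 * t)) ≤ 1 :=
    exp_le_one_iff.2 (div_nonpos_of_nonpos_of_nonneg (by nlinarith [sq_nonneg z]) (by positivity))
  have hzG : z / t * exp (-z ^ 2 / (4 * t)) ≤ 1 := by
    have h := mul_exp_neg_sq_div_four_le_one (z / √t)
    rw [div_pow, hsq, show -(z ^ 2 / t / 4) = -z ^ 2 / (4 * t) by field_simp] at h
    refine le_trans (mul_le_mul_of_nonneg_right ?_ (exp_pos _).le) h
    exact div_le_div_of_nonneg_left hz0 hs (by nlinarith)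
  have hE0 : 0 < exp (-z) := exp_pos _
  have hG0 : 0 < exp (-z ^ 2 / (4 * t)) := exp_pos _
  have hr0 : 0 < t ^ (-ε) := rpow_pos_of_pos ht0 _
  generalize exp (-z) = E at *
  generalize exp (-z ^ 2 / (4 * t)) = G at *
  generalize t ^ (-ε) = r at *
  have hA0 : 0 < 1 + C / √t := by positivity
  have hA2 : 1 + C / √t ≤ 2 := by
    have : C / √t ≤ 1 := (div_le_one hs).2 hCs
    linarith
  have hB0 : 0 < r + z / t := by positivity
  have hBG : (r + z / t) * G ≤ 2 := by nlinarith
  have hu0 : 0 ≤ u2 t x := by rw [hu]; positivity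
  have hfu := sub_mul_sq_le_of_abs_deriv_deriv_le hf hf0 hf'0 hK hu0
  have hεr : 1 / (2 * t) ≤ ε * r := by
    have h1 : 1 ≤ √t * (2 * ε) := (div_le_iff₀ (by positivity)).1 hεs
    rw [div_le_iff₀ (by positivity)]
    nlinarith [mul_le_mul hrs h1 zero_le_one (by positivity)]
  have hquad : K * (1 + C / √t) ^ 2 * ((r + z / t) * G) * E ≤ C / (2 * t * √t) :=
    calc K * (1 + C / √t) ^ 2 * ((r + z / t) * G) * E
        ≤ K * 2 ^ 2 * 2 * (exp 2 / (t * √t)) := by gcongr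
      _ = (16 * K * exp 2) / (2 * t * √t) := by field_simp; ring
      _ ≤ C / (2 * t * √t) := by gcongr; linarith
  have hquad' := mul_le_mul_of_nonneg_right hquad (by positivity : 0 ≤ E * G * (r + z / t))
  have hlin : 0 ≤ E * G * ((1 + C / √t) * ((ε * r - 1 / (2 * t)) / t
      + (r + z / t) * z / (4 * t ^ 2))) := by
    have := sub_nonneg.2 hεr
    positivity
  rw [hu] at hfu ⊢
  generalize f _ = F at *
  generalize hAdef : 1 + C / √t = A at *
  generalize C / (2 * t * √t) = D at *
  refine le_trans (sub_le_sub_left hfu _) ?_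
  have key : E * G * (-D * (r + z / t) + A * (-(ε * r / t) + (-2 + 1 / (2 * t)) / t - z / t ^ 2)
        + A * (r + z / t) * ((-2 + 1 / (2 * t)) * (-1 - z / (2 * t)) + z ^ 2 / (4 * t ^ 2)))
      - E * G * (A * ((r + z / t) * ((1 + z / (2 * t)) ^ 2 - 1 / (2 * t))
        - 2 / t * (1 + z / (2 * t))))
      - (A * (r + z / t) * E * G - K * (A * (r + z / t) * E * G) ^ 2)
      = (K * A ^ 2 * ((r + z / t) * G) * E * (E * G * (r + z / t)) - D * (E * G * (r + z / t)))
        - E * G * (A * ((ε * r - 1 / (2 * t)) / t + (r + z / t) * z / (4 * t ^ 2))) := by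
    field_simp
    ring
  rw [key]
  linarith
end

section
/- The function U(z) := (1 + e^z)^{-1} satisfies U'' + 2U' + f₂(U) = 0 on ℝ, where f₂(u) := u(1−u)(1+2u); moreover U is decreasing, U(−∞) = 1, U(+∞) = 0, and e^z U(z) → 1 as z → +∞. Hence for the reaction term f₂ (which is monostable with f₂'(0) = 1), the minimal-speed traveling wave has speed 2 and fast decay (the coefficient B in its expansion (Bz+A)e^{-z} vanishes). -/
open Real Filter Set

/-- The logistic profile `(1 + e^z)⁻¹` solves `U' = U² - U`. -/
theorem hasDerivAt_inv_one_add_exp (z : ℝ) :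
    HasDerivAt (fun z => (1 + Real.exp z)⁻¹)
      ((1 + Real.exp z)⁻¹ ^ 2 - (1 + Real.exp z)⁻¹) z := by
  have hpos : 1 + Real.exp z ≠ 0 := by positivity
  refine (((Real.hasDerivAt_exp z).const_add 1).fun_inv hpos).congr_deriv ?_
  field_simp
  ring

theorem hasDerivAt_mul_one_sub_mul_one_add_two_mul (u : ℝ) :
    HasDerivAt (fun u : ℝ => u * (1 - u) * (1 + 2 * u)) (1 + 2 * u - 6 * u ^ 2) u := by
  have h := ((hasDerivAt_id' u).fun_mul ((hasDerivAt_id' u).const_sub 1)).fun_mul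
    (((hasDerivAt_id' u).const_mul 2).const_add 1)
  refine h.congr_deriv ?_
  ring

/-- `U(z) = (1+e^z)⁻¹` is the minimal traveling wave of speed 2
for `f₂(u) = u(1−u)(1+2u)` (monostable with `f₂'(0) = 1`), and it has fast decay:
`e^z U(z) → 1` as `z → +∞` (so the coefficient `B` vanishes). -/
theorem statement_8
    (f₂ : ℝ → ℝ) (hf₂ : ∀ u, f₂ u = u * (1 - u) * (1 + 2 * u))
    (U : ℝ → ℝ) (hU : ∀ z, U z = (1 + Real.exp z)⁻¹) :
    (∀ z, deriv (deriv U) z + 2 * deriv U z + f₂ (U z) = 0) ∧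
    StrictAnti U ∧
    Tendsto U atBot (nhds 1) ∧ Tendsto U atTop (nhds 0) ∧
    Tendsto (fun z => Real.exp z * U z) atTop (nhds 1) ∧
    -- monostability of `f₂` with `f₂'(0) = 1`
    (f₂ 0 = 0 ∧ f₂ 1 = 0 ∧ deriv f₂ 0 = 1 ∧ deriv f₂ 1 < 0 ∧
      ∀ s ∈ Set.Ioo (0:ℝ) 1, 0 < f₂ s) := by
  obtain rfl : f₂ = fun u => u * (1 - u) * (1 + 2 * u) := funext hf₂
  obtain rfl : U = fun z => (1 + Real.exp z)⁻¹ := funext hU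
  have hderiv : deriv (fun z => (1 + Real.exp z)⁻¹) =
      fun z => (1 + Real.exp z)⁻¹ ^ 2 - (1 + Real.exp z)⁻¹ :=
    funext fun z => (hasDerivAt_inv_one_add_exp z).deriv
  have htop : Tendsto (fun z => (1 + Real.exp z)⁻¹) atTop (nhds 0) :=
    (tendsto_atTop_add_const_left atTop 1 Real.tendsto_exp_atTop).inv_tendsto_atTop
  refine ⟨fun z => ?_, fun x y hxy => ?_, ?_, htop, ?_, by simp, by simp, ?_, ?_, ?_⟩
  · have h := hasDerivAt_inv_one_add_exp z
    rw [hderiv, ((h.fun_pow 2).fun_sub h).deriv]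
    push_cast
    ring
  · have := Real.exp_lt_exp.2 hxy
    exact inv_strictAnti₀ (by positivity) (by linarith)
  · simpa using (Real.tendsto_exp_atBot.const_add 1).inv₀ (by norm_num)
  · have h := htop.const_sub 1
    rw [sub_zero] at h
    refine h.congr fun z => ?_
    have : 1 + Real.exp z ≠ 0 := by positivity
    field_simp
    ring
  · rw [(hasDerivAt_mul_one_sub_mul_one_add_two_mul 0).deriv]
    norm_num
  · rw [(hasDerivAt_mul_one_sub_mul_one_add_two_mul 1).deriv]
    norm_num
  · rintro s ⟨h0, h1⟩
    have := sub_pos.2 h1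
    positivity
end

section
/- Fix ε ∈ (0,1/2) and C > 0, and define w̲(τ,y) := (1 + C e^{−τ/2}) · ( y e^{−y²/8} + e^{−y²/8} e^{τ(1/2−ε)} ). Then there exists τ₀ > 0 such that for all τ ≥ τ₀ and all y ≥ 0, ∂_τ w̲ − ∂_yy w̲ + (y²/16 − 3/4) w̲ + (1/2) e^{−τ/2} ( ∂_y w̲ − (y/4) w̲ ) ≤ 0. -/
open Real Filter Set

theorem hasDerivAt_exp_neg_sq_div_eight (y : ℝ) :
    HasDerivAt (fun x : ℝ => Real.exp (-x ^ 2 / 8)) (-(y / 4) * Real.exp (-y ^ 2 / 8)) y := by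
  convert (((hasDerivAt_pow 2 y).fun_neg.div_const 8).exp) using 1
  norm_num
  ring

/-- the combination `w̲(τ,y) = (1 + Ce^{−τ/2})(y e^{−y²/8}
+ e^{−y²/8} e^{τ(1/2−ε)})` is a subsolution of the self-similar equation on
`{y ≥ 0}` for large times. -/
theorem statement_9 (ε C : ℝ) (hε : ε ∈ Set.Ioo (0:ℝ) (1/2)) (hC : 0 < C)
    (w : ℝ → ℝ → ℝ)
    (hw : ∀ τ y : ℝ, w τ y =
      (1 + C * Real.exp (-τ / 2))
        * (y * Real.exp (-y ^ 2 / 8)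
          + Real.exp (-y ^ 2 / 8) * Real.exp (τ * (1 / 2 - ε)))) :
    ∃ τ₀ > (0:ℝ), ∀ τ ≥ τ₀, ∀ y ≥ (0:ℝ),
      deriv (fun s => w s y) τ - deriv (deriv (w τ)) y
        + (y ^ 2 / 16 - 3 / 4) * w τ y
        + 1 / 2 * Real.exp (-τ / 2) * (deriv (w τ) y - y / 4 * w τ y) ≤ 0 := by
  obtain ⟨hε0, hε1⟩ := hε
  have hwy : ∀ τ y : ℝ, HasDerivAt (w τ)
      ((1 + C * Real.exp (-τ / 2)) * Real.exp (-y ^ 2 / 8)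
        * (1 - y / 4 * (y + Real.exp (τ * (1 / 2 - ε))))) y := by
    intro τ y
    rw [funext (hw τ)]
    have hg := hasDerivAt_exp_neg_sq_div_eight y
    refine ((((hasDerivAt_id' y).fun_mul hg).fun_add
      (hg.mul_const (Real.exp (τ * (1 / 2 - ε))))).const_mul
        (1 + C * Real.exp (-τ / 2))).congr_deriv ?_
    ring
  have hwyy : ∀ τ y : ℝ, deriv (deriv (w τ)) y =
      (1 + C * Real.exp (-τ / 2)) * Real.exp (-y ^ 2 / 8)
        * ((y ^ 2 / 16 - 3 / 4) * y
          + (y ^ 2 / 16 - 1 / 4) * Real.exp (τ * (1 / 2 - ε))) := by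
    intro τ y
    rw [funext fun x => (hwy τ x).deriv]
    have hg := (hasDerivAt_exp_neg_sq_div_eight y).const_mul (1 + C * Real.exp (-τ / 2))
    have hp := (((hasDerivAt_id' y).div_const 4).fun_mul
      ((hasDerivAt_id' y).add_const (Real.exp (τ * (1 / 2 - ε))))).const_sub 1
    rw [(hg.fun_mul hp).deriv]
    ring
  have hwτ : ∀ τ y : ℝ, deriv (fun s => w s y) τ =
      Real.exp (-y ^ 2 / 8) * (-(C * Real.exp (-τ / 2) / 2) * (y + Real.exp (τ * (1 / 2 - ε)))
        + (1 + C * Real.exp (-τ / 2)) * ((1 / 2 - ε) * Real.exp (τ * (1 / 2 - ε)))) := by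
    intro τ y
    rw [funext fun s => hw s y]
    have hE := ((((hasDerivAt_id' τ).fun_neg.div_const 2).exp).const_mul C).const_add 1
    have hD := ((((hasDerivAt_id' τ).mul_const (1 / 2 - ε)).exp).const_mul
      (Real.exp (-y ^ 2 / 8))).const_add (y * Real.exp (-y ^ 2 / 8))
    rw [(hE.fun_mul hD).deriv]
    ring
  refine ⟨1 / ε, by positivity, fun τ hτ y hy => ?_⟩
  have hτ0 : 0 < τ := lt_of_lt_of_le (by positivity) hτ
  have hετ : 1 ≤ τ * ε := (div_le_iff₀ hε0).1 hτ
  have hD : 1 ≤ Real.exp (τ * (1 / 2 - ε)) :=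
    Real.one_le_exp (mul_nonneg hτ0.le (by linarith))
  have hE : Real.exp (-τ / 2) ≤ 2 * ε := by
    rw [neg_div, Real.exp_neg, inv_le_comm₀ (Real.exp_pos _) (by positivity),
      inv_le_iff_one_le_mul₀ (by positivity)]
    nlinarith [Real.add_one_le_exp (τ / 2)]
  rw [hwτ, hwyy, (hwy τ y).deriv, hw]
  have hE0 := Real.exp_pos (-τ / 2)
  have hG0 := Real.exp_pos (-y ^ 2 / 8)
  generalize Real.exp (-τ / 2) = E at *
  generalize Real.exp (-y ^ 2 / 8) = G at *
  generalize Real.exp (τ * (1 / 2 - ε)) = D at *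
  have hD0 : 0 < D := by linarith
  have hED : 0 ≤ ε * D - E / 2 := by nlinarith
  have key : 0 ≤ G * (C * E / 2 * (y + D)
      + (1 + C * E) * ((ε * D - E / 2) + E / 4 * (y * (y + D)))) := by positivity
  linarith
end

section
/- Fix ε ∈ (0,1/2) and define w₀(τ,y) := e^{−y²/8} e^{τ(1/2+ε)} − 2y e^{−y²/8} e^{2ετ} + y² e^{−y²/8} e^{2ετ}. Then there exists τ₁ ≥ 0 such that: (a) for all τ ≥ τ₁ and all y ≥ 0, w₀(τ,y) > 0; and (b) for all τ ≥ τ₁ and all y ∈ [0,3], ∂_τ w₀ − ∂_yy w₀ + (y²/16 − 3/4) w₀ + (1/2) e^{−τ/2} ( ∂_y w₀ − (y/4) w₀ ) > 0. -/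
open Real Filter Set

/-- Derivative of a Gaussian times a function. -/
lemma hasDerivAt_gaussian_mul {p : ℝ → ℝ} {p' y : ℝ} (hp : HasDerivAt p p' y) :
    HasDerivAt (fun x => Real.exp (-x ^ 2 / 8) * p x)
      (Real.exp (-y ^ 2 / 8) * (p' - y / 4 * p y)) y := by
  have hg : HasDerivAt (fun x : ℝ => Real.exp (-x ^ 2 / 8))
      (Real.exp (-y ^ 2 / 8) * (-(2 * y) / 8)) y := by
    simpa using (((hasDerivAt_id y).pow 2).neg.div_const 8).exp
  exact (hg.mul hp).congr_deriv (by ring)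

/-- Once `ε A > 20 B`, the leading term `ε A` dominates all the others. -/
lemma supersolution_polynomial_pos {ε A B E y : ℝ} (hε : 0 < ε) (hε' : ε < 1 / 2) (hB : 0 < B)
    (hE : 0 < E) (hE1 : E ≤ 1) (hEA : E * A ≤ B) (hA : 20 * B < ε * A)
    (hy : 0 ≤ y) (hy3 : y ≤ 3) :
    0 < ε * A + B * (2 * ε * (y ^ 2 - 2 * y) - 2 + y ^ 2 / 2)
      + 1 / 2 * E * (B * (2 * y - 2) - y / 2 * (A - 2 * y * B + y ^ 2 * B)) := by
  have h1 : -4 ≤ 2 * ε * (y ^ 2 - 2 * y) - 2 + y ^ 2 / 2 := by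
    nlinarith [mul_nonneg hε.le (sq_nonneg (y - 1)), sq_nonneg y]
  have h2 : -4 * B ≤ B * (2 * ε * (y ^ 2 - 2 * y) - 2 + y ^ 2 / 2) := by nlinarith
  have h3 : -16 ≤ 2 * y - 2 + y ^ 2 - y ^ 3 / 2 := by
    nlinarith [mul_nonneg (sq_nonneg y) (sub_nonneg.2 hy3), mul_nonneg hy (sub_nonneg.2 hy3)]
  have h4 : E * B ≤ B := by nlinarith
  have h5 : -16 * (E * B) ≤ E * B * (2 * y - 2 + y ^ 2 - y ^ 3 / 2) := by
    nlinarith [mul_pos hE hB]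
  have h6 : y * (E * A) ≤ 3 * B := by
    nlinarith [mul_le_mul_of_nonneg_left hEA hy]
  nlinarith

/-- the combination
`w₀(τ,y) = e^{−y²/8}e^{τ(1/2+ε)} − 2y e^{−y²/8}e^{2ετ} + y² e^{−y²/8}e^{2ετ}` is
eventually positive on `{y ≥ 0}` and a strict supersolution of the self-similar
equation on `[0,3]`. -/
theorem statement_14 (ε : ℝ) (hε : ε ∈ Set.Ioo (0:ℝ) (1/2))
    (w₀ : ℝ → ℝ → ℝ)
    (hw₀ : ∀ τ y : ℝ, w₀ τ y =
      Real.exp (-y ^ 2 / 8) * Real.exp (τ * (1 / 2 + ε))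
        - 2 * y * Real.exp (-y ^ 2 / 8) * Real.exp (2 * ε * τ)
        + y ^ 2 * Real.exp (-y ^ 2 / 8) * Real.exp (2 * ε * τ)) :
    ∃ τ₁ ≥ (0:ℝ),
      (∀ τ ≥ τ₁, ∀ y ≥ (0:ℝ), 0 < w₀ τ y) ∧
      (∀ τ ≥ τ₁, ∀ y ∈ Set.Icc (0:ℝ) 3,
        0 < deriv (fun s => w₀ s y) τ - deriv (deriv (w₀ τ)) y
          + (y ^ 2 / 16 - 3 / 4) * w₀ τ y
          + 1 / 2 * Real.exp (-τ / 2)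
            * (deriv (w₀ τ) y - y / 4 * w₀ τ y)) := by
  obtain ⟨h0, h1⟩ := hε
  have hev : ∀ᶠ τ : ℝ in atTop, 20 / ε < Real.exp (τ * (1 / 2 - ε)) :=
    (Real.tendsto_exp_atTop.comp
      (tendsto_id.atTop_mul_const (sub_pos.2 h1))).eventually_gt_atTop _
  obtain ⟨T, hT⟩ := eventually_atTop.1 hev
  have hA : ∀ τ ≥ max T 0, 20 * Real.exp (2 * ε * τ) < ε * Real.exp (τ * (1 / 2 + ε)) := by
    intro τ hτ
    have h := (div_lt_iff₀ h0).1 (hT τ (le_trans (le_max_left _ _) hτ))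
    have hsplit : Real.exp (τ * (1 / 2 + ε))
        = Real.exp (τ * (1 / 2 - ε)) * Real.exp (2 * ε * τ) := by
      rw [← Real.exp_add]; ring_nf
    rw [hsplit]
    nlinarith [Real.exp_pos (2 * ε * τ)]
  refine ⟨max T 0, le_max_right _ _, fun τ hτ y _ => ?_, fun τ hτ y hy => ?_⟩
  · have hB := Real.exp_pos (2 * ε * τ)
    have hpos : 0 < Real.exp (τ * (1 / 2 + ε)) - 2 * y * Real.exp (2 * ε * τ)
        + y ^ 2 * Real.exp (2 * ε * τ) := by
      nlinarith [hA τ hτ, mul_nonneg hB.le (sq_nonneg (y - 1)),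
        Real.exp_pos (τ * (1 / 2 + ε))]
    rw [hw₀]
    linarith [mul_pos (Real.exp_pos (-y ^ 2 / 8)) hpos]
  have hτ0 : 0 ≤ τ := le_trans (le_max_right _ _) hτ
  have hdτ : deriv (fun s => w₀ s y) τ = Real.exp (-y ^ 2 / 8)
      * ((1 / 2 + ε) * Real.exp (τ * (1 / 2 + ε))
        + 2 * ε * Real.exp (2 * ε * τ) * (y ^ 2 - 2 * y)) := by
    have hα : HasDerivAt (fun s : ℝ => Real.exp (s * (1 / 2 + ε)))
        (Real.exp (τ * (1 / 2 + ε)) * (1 / 2 + ε)) τ := by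
      simpa using ((hasDerivAt_id τ).mul_const (1 / 2 + ε)).exp
    have hβ : HasDerivAt (fun s : ℝ => Real.exp (2 * ε * s))
        (Real.exp (2 * ε * τ) * (2 * ε)) τ := by
      simpa using ((hasDerivAt_id τ).const_mul (2 * ε)).exp
    simp only [hw₀]
    refine HasDerivAt.deriv ((((hα.const_mul (Real.exp (-y ^ 2 / 8))).sub
      (hβ.const_mul (2 * y * Real.exp (-y ^ 2 / 8)))).add
      (hβ.const_mul (y ^ 2 * Real.exp (-y ^ 2 / 8)))).congr_deriv ?_)
    ring
  have hE1 : Real.exp (-τ / 2) ≤ 1 := Real.exp_le_one_iff.2 (by linarith)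
  have hEA : Real.exp (-τ / 2) * Real.exp (τ * (1 / 2 + ε)) ≤ Real.exp (2 * ε * τ) := by
    rw [← Real.exp_add]
    exact Real.exp_le_exp.2 (by nlinarith [mul_nonneg h0.le hτ0])
  have key := supersolution_polynomial_pos h0 h1 (Real.exp_pos (2 * ε * τ))
    (Real.exp_pos (-τ / 2)) hE1 hEA (hA τ hτ) hy.1 hy.2
  rw [hdτ]
  generalize Real.exp (-τ / 2) = E at key ⊢
  have hw : w₀ τ = fun x => Real.exp (-x ^ 2 / 8)
      * (Real.exp (τ * (1 / 2 + ε)) - 2 * x * Real.exp (2 * ε * τ)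
        + x ^ 2 * Real.exp (2 * ε * τ)) := by
    funext x; rw [hw₀]; ring
  rw [hw]
  generalize Real.exp (τ * (1 / 2 + ε)) = A at key ⊢
  generalize Real.exp (2 * ε * τ) = B at key ⊢
  have hp : ∀ x : ℝ, HasDerivAt (fun x : ℝ => A - 2 * x * B + x ^ 2 * B)
      (B * (2 * x - 2)) x := fun x =>
    (((((hasDerivAt_id x).const_mul 2).mul_const B).const_sub A).add
      (((hasDerivAt_id x).pow 2).mul_const B)).congr_deriv (by simp; ring)
  have hq : ∀ x : ℝ, HasDerivAt
      (fun x : ℝ => B * (2 * x - 2) - x / 4 * (A - 2 * x * B + x ^ 2 * B))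
      (2 * B - (1 / 4 * (A - 2 * x * B + x ^ 2 * B) + x / 4 * (B * (2 * x - 2)))) x := fun x =>
    (((((hasDerivAt_id x).const_mul 2).sub_const 2).const_mul B).sub
      (((hasDerivAt_id x).div_const 4).mul (hp x))).congr_deriv (by simp; ring)
  rw [funext fun x => (hasDerivAt_gaussian_mul (hp x)).deriv,
    (hasDerivAt_gaussian_mul (hq y)).deriv]
  exact (mul_pos (Real.exp_pos (-y ^ 2 / 8)) key).trans_eq (by ring)
end

section
/- Assume f is C² monostable with f'(0)=1 and ‖f''‖_∞ < ∞. For any ε ∈ (0,1/4) there exist C > 0, T > 0 and a positive function ũ defined for t ≥ T and z ≥ 0 such that: (a) the function ū₂(t,x) := (1 − C t^{−1/4}) · ũ(t, x − 2t + (1/2) ln t) satisfies ∂_t ū₂ − ∂_xx ū₂ − f(ū₂) ≥ 0 for all t ≥ T and x ≥ 2t + ln t − 2; (b) ũ(t,z) = t^{ε} [1 − 2z t^{−(1−ε)} + z² t^{−(3/2−ε)}] e^{−z} e^{−z²/(4t)} for all t ≥ T and z ∈ [0, √t]; and (c) ũ(t,z) ≤ t^{2ε+1/2} e^{−z} for all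 t ≥ T and z ≥ 0. -/
open Real Filter Set

/-- The `C²` truncated cubic `s ↦ (s₊)³`. -/
noncomputable def posCube (s : ℝ) : ℝ := max s 0 ^ 3

theorem hasDerivAt_posPart_pow (n : ℕ) (s : ℝ) :
    HasDerivAt (fun s : ℝ => max s 0 ^ (n + 2)) ((n + 2) * max s 0 ^ (n + 1)) s := by
  rcases lt_trichotomy s 0 with h | h | h
  · rw [max_eq_right h.le]
    have : (fun s : ℝ => max s 0 ^ (n + 2)) =ᶠ[nhds s] fun _ => 0 := by
      filter_upwards [Iio_mem_nhds h] with x hx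
      rw [max_eq_right (le_of_lt hx)]; simp
    simpa using (hasDerivAt_const s (0 : ℝ)).congr_of_eventuallyEq this
  · subst h
    rw [hasDerivAt_iff_isLittleO]
    have h1 : (fun x : ℝ => max x 0 ^ (n + 2)) =O[nhds 0] fun x => x ^ (n + 2) := by
      refine Asymptotics.IsBigO.of_bound 1 (Eventually.of_forall fun x => ?_)
      rw [one_mul, norm_pow, norm_pow]
      refine pow_le_pow_left₀ (norm_nonneg _) ?_ _
      rw [Real.norm_eq_abs, Real.norm_eq_abs, abs_of_nonneg (le_max_right _ _)]
      exact max_le (le_abs_self x) (abs_nonneg x)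
    have h2 := h1.trans_isLittleO
      (Asymptotics.isLittleO_pow_id (𝕜 := ℝ) (n := n + 2) (by omega))
    simpa using h2
  · rw [max_eq_left h.le]
    have : (fun s : ℝ => max s 0 ^ (n + 2)) =ᶠ[nhds s] fun s => s ^ (n + 2) := by
      filter_upwards [Ioi_mem_nhds h] with x hx
      rw [max_eq_left (le_of_lt hx)]
    have h2 := (hasDerivAt_pow (n + 2) s).congr_of_eventuallyEq this
    exact h2.congr_deriv (by push_cast; rfl)

theorem hasDerivAt_posCube (s : ℝ) : HasDerivAt posCube (3 * max s 0 ^ 2) s := by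
  exact (hasDerivAt_posPart_pow 1 s).congr_deriv (by norm_num)

theorem hasDerivAt_posPart_sq (s : ℝ) :
    HasDerivAt (fun s : ℝ => max s 0 ^ 2) (2 * max s 0) s := by
  exact (hasDerivAt_posPart_pow 0 s).congr_deriv (by norm_num)

/-- The profile of the supersolution in the self-similar variable `y = z / √t`, with
`A = t ^ ε` and `r = t ^ (-1/2)`. -/
noncomputable def profile (A r y : ℝ) : ℝ :=
  A * exp (-y ^ 2 / 4) + A ^ 2 * r * ((y ^ 2 - 2 * y) * exp (-y ^ 2 / 4))
    + posCube (y - 1) * exp (-y ^ 2 / 8)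

/-- The first derivative of `profile` in `y`. -/
noncomputable def profileD (A r y : ℝ) : ℝ :=
  A * (-(y / 2) * exp (-y ^ 2 / 4))
    + A ^ 2 * r * ((2 * y - 2 - y ^ 3 / 2 + y ^ 2) * exp (-y ^ 2 / 4))
    + (3 * max (y - 1) 0 ^ 2 - y / 4 * posCube (y - 1)) * exp (-y ^ 2 / 8)

/-- The second derivative of `profile` in `y`. -/
noncomputable def profileDD (A r y : ℝ) : ℝ :=
  A * ((y ^ 2 / 4 - 1 / 2) * exp (-y ^ 2 / 4))
    + A ^ 2 * r * ((2 - 5 / 2 * y ^ 2 + 3 * y + y ^ 4 / 4 - y ^ 3 / 2) * exp (-y ^ 2 / 4))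
    + (6 * max (y - 1) 0 - posCube (y - 1) / 4 - 3 / 2 * y * max (y - 1) 0 ^ 2
        + y ^ 2 / 16 * posCube (y - 1)) * exp (-y ^ 2 / 8)

theorem hasDerivAt_gauss (c y : ℝ) :
    HasDerivAt (fun y : ℝ => exp (-y ^ 2 / c)) (-(2 * y / c) * exp (-y ^ 2 / c)) y := by
  refine (((hasDerivAt_pow 2 y).neg.div_const c).exp).congr_deriv ?_
  simp only [Pi.neg_apply]; push_cast; ring

theorem hasDerivAt_profile (A r y : ℝ) :
    HasDerivAt (profile A r) (profileD A r y) y := by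
  have hq := (hasDerivAt_posCube (y - 1)).comp y ((hasDerivAt_id y).sub_const 1)
  have h := (((hasDerivAt_gauss 4 y).const_mul A).add
    ((((hasDerivAt_pow 2 y).sub ((hasDerivAt_id y).const_mul 2)).mul
      (hasDerivAt_gauss 4 y)).const_mul (A ^ 2 * r))).add (hq.mul (hasDerivAt_gauss 8 y))
  refine h.congr_deriv ?_
  simp [profileD]; ring

theorem hasDerivAt_profileD (A r y : ℝ) :
    HasDerivAt (profileD A r) (profileDD A r y) y := by
  have hq := (hasDerivAt_posCube (y - 1)).comp y ((hasDerivAt_id y).sub_const 1)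
  have hs := (hasDerivAt_posPart_sq (y - 1)).comp y ((hasDerivAt_id y).sub_const 1)
  have h := (((((hasDerivAt_id y).div_const 2).neg.mul (hasDerivAt_gauss 4 y)).const_mul A).add
    (((((((hasDerivAt_id y).const_mul 2).sub_const 2).sub
        ((hasDerivAt_pow 3 y).div_const 2)).add (hasDerivAt_pow 2 y)).mul
      (hasDerivAt_gauss 4 y)).const_mul (A ^ 2 * r))).add
    (((hs.const_mul 3).sub (((hasDerivAt_id y).div_const 4).mul hq)).mul (hasDerivAt_gauss 8 y))
  refine h.congr_deriv ?_
  simp [profileDD]; ring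

theorem exp_neg_sq_div_four (y : ℝ) : exp (-y ^ 2 / 4) = exp (-y ^ 2 / 8) ^ 2 := by
  rw [← Real.exp_nat_mul]; congr 1; push_cast; ring

theorem profile_pos {A r y : ℝ} (hA : 0 < A) (hr : 0 < r) (hAr : A * r < 1) :
    0 < profile A r y := by
  have hq : 0 ≤ posCube (y - 1) := by unfold posCube; positivity
  have h : profile A r y = (A * (1 - A * r) + A ^ 2 * r * (y - 1) ^ 2) * exp (-y ^ 2 / 4)
      + posCube (y - 1) * exp (-y ^ 2 / 8) := by unfold profile; ring
  have : 0 < A * (1 - A * r) := mul_pos hA (by linarith)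
  rw [h]
  have h2 : 0 ≤ A ^ 2 * r * (y - 1) ^ 2 := by positivity
  exact add_pos_of_pos_of_nonneg
    (mul_pos (add_pos_of_pos_of_nonneg this h2) (exp_pos _))
    (mul_nonneg hq (exp_pos _).le)

theorem profile_le {A r y : ℝ} (hA : 1 ≤ A) (hr : 0 < r) (hy : 0 ≤ y) (hAr : A * r ≤ 1) :
    profile A r y ≤ 133 * A := by
  have h1 : exp (-y ^ 2 / 4) ≤ 1 := by rw [Real.exp_le_one_iff]; nlinarith [sq_nonneg y]
  have h2 : y ^ 2 * exp (-y ^ 2 / 4) ≤ 4 := by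
    have := Real.add_one_le_exp (y ^ 2 / 4)
    rw [neg_div, Real.exp_neg, ← div_eq_mul_inv, div_le_iff₀ (exp_pos _)]
    linarith
  have h3 : posCube (y - 1) * exp (-y ^ 2 / 8) ≤ 128 := by
    have h := Real.quadratic_le_exp_of_nonneg (x := y ^ 2 / 8) (by positivity)
    rw [neg_div, Real.exp_neg, ← div_eq_mul_inv, div_le_iff₀ (exp_pos _)]
    have : posCube (y - 1) ≤ y ^ 4 := by
      unfold posCube
      rcases le_total y 1 with hy1 | hy1
      · rw [max_eq_right (by linarith), zero_pow three_ne_zero]; positivity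
      · rw [max_eq_left (by linarith)]
        calc (y - 1) ^ 3 ≤ y ^ 3 := pow_le_pow_left₀ (by linarith) (by linarith) 3
          _ ≤ y ^ 4 := pow_le_pow_right₀ hy1 (by norm_num)
    nlinarith [sq_nonneg y]
  have h4 : A ^ 2 * r * ((y ^ 2 - 2 * y) * exp (-y ^ 2 / 4)) ≤ A * 4 := by
    calc A ^ 2 * r * ((y ^ 2 - 2 * y) * exp (-y ^ 2 / 4))
        ≤ A ^ 2 * r * (y ^ 2 * exp (-y ^ 2 / 4)) := by gcongr; linarith
      _ = A * ((A * r) * (y ^ 2 * exp (-y ^ 2 / 4))) := by ring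
      _ ≤ A * (1 * 4) := by gcongr
      _ = A * 4 := by ring
  have h5 : A * exp (-y ^ 2 / 4) ≤ A * 1 := by gcongr
  unfold profile
  linarith

/-- The linear parabolic operator, rescaled by `t`, applied to `profile`. -/
noncomputable def linOp (ε A r y : ℝ) : ℝ :=
  ε * A * exp (-y ^ 2 / 4)
    + (2 * ε - 1 / 2) * (A ^ 2 * r) * ((y ^ 2 - 2 * y) * exp (-y ^ 2 / 4))
    - profile A r y / 2 - y / 2 * profileD A r y - profileDD A r y + r * profileD A r y / 2

theorem linOp_eq (ε A r y : ℝ) :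
    linOp ε A r y = exp (-y ^ 2 / 8) * (exp (-y ^ 2 / 8) *
      (A * (ε - y * r / 4 + A * r * ((2 * ε + 1 / 2) * y ^ 2 - 4 * ε * y - 2 + r * (y - 1)))
        - (A * r) ^ 2 * (y ^ 3 - 2 * y ^ 2) / 4)
      + ((y ^ 2 / 16 - 1 / 4 - y * r / 8) * max (y - 1) 0 ^ 3 - 6 * max (y - 1) 0
        + 3 / 2 * r * max (y - 1) 0 ^ 2)) := by
  unfold linOp profile profileD profileDD posCube
  rw [exp_neg_sq_div_four]
  ring

theorem linOp_ge {ε A r y : ℝ} (hε : 0 < ε) (hε' : ε < 1 / 4) (hr : 0 < r) (hr1 : r ≤ 1)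
    (hy : 0 ≤ y) (hA : 0 < A) :
    exp (-y ^ 2 / 8) * (exp (-y ^ 2 / 8) *
      (A * (ε - y * r / 4 - 4 * (A * r)) - (A * r) ^ 2 * y ^ 3 / 4)
      + ((y ^ 2 / 16 - 1 / 4 - y * r / 8) * max (y - 1) 0 ^ 3 - 6 * max (y - 1) 0))
    ≤ linOp ε A r y := by
  rw [linOp_eq]
  have hquad : -4 ≤ (2 * ε + 1 / 2) * y ^ 2 - 4 * ε * y - 2 + r * (y - 1) := by
    nlinarith [mul_nonneg hr.le hy, mul_nonneg hε.le (sq_nonneg (y - 1)), sq_nonneg y]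
  have h1 : A * r * (-4) ≤
      A * r * ((2 * ε + 1 / 2) * y ^ 2 - 4 * ε * y - 2 + r * (y - 1)) := by gcongr
  have h2 : A * (ε - y * r / 4 - 4 * (A * r)) ≤ A * (ε - y * r / 4 + A * r *
      ((2 * ε + 1 / 2) * y ^ 2 - 4 * ε * y - 2 + r * (y - 1))) := by gcongr; linarith
  have h3 : 0 ≤ (A * r) ^ 2 * y ^ 2 := by positivity
  have h4 : 0 ≤ 3 / 2 * r * max (y - 1) 0 ^ 2 := by positivity
  refine mul_le_mul_of_nonneg_left ?_ (exp_pos _).le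
  have h5 := mul_le_mul_of_nonneg_left
    (show A * (ε - y * r / 4 - 4 * (A * r)) - (A * r) ^ 2 * y ^ 3 / 4 ≤
      A * (ε - y * r / 4 + A * r * ((2 * ε + 1 / 2) * y ^ 2 - 4 * ε * y - 2 + r * (y - 1)))
        - (A * r) ^ 2 * (y ^ 3 - 2 * y ^ 2) / 4 by linarith) (exp_pos (-y ^ 2 / 8)).le
  linarith

theorem linOp_nonneg_of_le_five {ε A r y : ℝ} (hε : 0 < ε) (hε' : ε < 1 / 4) (hr : 0 < r)
    (hy : 0 ≤ y) (h5 : y ≤ 5) (hA0 : 0 < A) (hrδ : r ≤ ε / 100) (hAr : A * r ≤ ε / 100)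
    (hA : 176 * exp (25 / 8) / ε ≤ A) : 0 ≤ linOp ε A r y := by
  refine le_trans (mul_nonneg (exp_pos _).le ?_)
    (linOp_ge hε hε' hr (by linarith) hy hA0)
  set E := exp (-y ^ 2 / 8) with hE
  have hE0 : 0 < E := exp_pos _
  have hAε : 0 < A * ε := by positivity
  set b := A * (ε - y * r / 4 - 4 * (A * r)) - (A * r) ^ 2 * y ^ 3 / 4 with hb
  have hbA : A * ε / 2 ≤ b := by
    have h1 : y * r ≤ 5 * (ε / 100) := by gcongr
    have h3 : y ^ 3 ≤ 5 ^ 3 := by gcongr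
    have h2 : (A * r) ^ 2 * y ^ 3 ≤ A * ε * (1 / 100 * (1 / 400) * 125) := by
      calc (A * r) ^ 2 * y ^ 3 = A * ((A * r) * r * y ^ 3) := by ring
        _ ≤ A * ((ε / 100) * (1 / 400) * 5 ^ 3) := by gcongr; linarith
        _ = _ := by ring
    have h4 : A * (ε - 5 * (ε / 100) / 4 - 4 * (ε / 100)) ≤
      A * (ε - y * r / 4 - 4 * (A * r)) := by gcongr
    linarith
  rcases le_total y 1 with h1 | h1
  · rw [max_eq_right (by linarith)]
    have : 0 ≤ E * b := mul_nonneg hE0.le (by linarith)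
    simpa using this
  · rw [max_eq_left (by linarith)]
    have hEl : exp (-(25 / 8)) ≤ E := by
      rw [hE]; apply Real.exp_le_exp.mpr; nlinarith
    have h88 : 88 ≤ E * b := by
      have h6 : 176 * exp (25 / 8) ≤ A * ε := by rwa [div_le_iff₀ hε] at hA
      calc (88 : ℝ) = exp (-(25 / 8)) * (176 * exp (25 / 8) / 2) := by
            rw [Real.exp_neg]; field_simp; norm_num
        _ ≤ E * b := by gcongr; linarith
    have hs0 : 0 ≤ y - 1 := by linarith
    have hs3 : (y - 1) ^ 3 ≤ 64 := by
      calc (y - 1) ^ 3 ≤ 4 ^ 3 := by gcongr; linarith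
        _ = 64 := by norm_num
    have hyr : y * r ≤ 5 * 1 := by gcongr; linarith
    have hc : -1 ≤ y ^ 2 / 16 - 1 / 4 - y * r / 8 := by linarith [sq_nonneg y]
    have h7 : -1 * (y - 1) ^ 3 ≤ (y ^ 2 / 16 - 1 / 4 - y * r / 8) * (y - 1) ^ 3 := by gcongr
    linarith

theorem linOp_nonneg_of_five_le {ε A r y : ℝ} (hε : 0 < ε) (hε' : ε < 1 / 4) (hr : 0 < r)
    (h5 : 5 ≤ y) (hA0 : 0 < A) (hrδ : r ≤ ε / 100) (hAr : A * r ≤ ε / 100) :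
    0 ≤ linOp ε A r y := by
  refine le_trans (mul_nonneg (exp_pos _).le ?_)
    (linOp_ge hε hε' hr (by linarith) (by linarith) hA0)
  have hE0 : 0 < exp (-y ^ 2 / 8) := exp_pos _
  have hE1 : exp (-y ^ 2 / 8) ≤ 1 := by rw [Real.exp_le_one_iff]; nlinarith [sq_nonneg y]
  generalize exp (-y ^ 2 / 8) = E at hE0 hE1 ⊢
  have hAr0 : 0 < A * r := by positivity
  rw [max_eq_left (by linarith)]
  have hy3 : y ^ 3 ≤ 8 * (y - 1) ^ 3 := by
    calc y ^ 3 ≤ (2 * (y - 1)) ^ 3 := by gcongr; linarith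
      _ = _ := by ring
  have hyy : y ≤ y ^ 3 := le_self_pow₀ (by linarith) (by norm_num)
  have hs0 : 0 ≤ y - 1 := by linarith
  have h4 : 0 ≤ (y - 1) ^ 3 := by positivity
  have hbl : -((y - 1) ^ 3 / 8) ≤
      A * (ε - y * r / 4 - 4 * (A * r)) - (A * r) ^ 2 * y ^ 3 / 4 := by
    have h1 : A * r * y ≤ 1 / 400 * y := by gcongr; linarith
    have h2 : (A * r) ^ 2 * y ^ 3 ≤ (1 / 400) ^ 2 * y ^ 3 := by gcongr; linarith
    have h3 : 0 ≤ A * (ε - 4 * (A * r)) := mul_nonneg (by linarith) (by linarith)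
    linarith
  generalize A * (ε - y * r / 4 - 4 * (A * r)) - (A * r) ^ 2 * y ^ 3 / 4 = b at hbl ⊢
  have hEb : -((y - 1) ^ 3 / 8) ≤ E * b :=
    calc -((y - 1) ^ 3 / 8) = 1 * -((y - 1) ^ 3 / 8) := by ring
      _ ≤ E * -((y - 1) ^ 3 / 8) := mul_le_mul_of_nonpos_right hE1 (by linarith)
      _ ≤ E * b := by gcongr
  have hyr : y * r ≤ y * 1 := by gcongr; linarith
  have hc : 1 / 2 ≤ y ^ 2 / 16 - 1 / 4 - y * r / 8 := by nlinarith
  have h7 : 1 / 2 * (y - 1) ^ 3 ≤ (y ^ 2 / 16 - 1 / 4 - y * r / 8) * (y - 1) ^ 3 := by gcongr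
  have h9 : 16 * (y - 1) ≤ (y - 1) ^ 3 := by
    calc 16 * (y - 1) = 4 ^ 2 * (y - 1) := by norm_num
      _ ≤ (y - 1) ^ 2 * (y - 1) := by gcongr; linarith
      _ = (y - 1) ^ 3 := by ring
  linarith

theorem linOp_nonneg {ε A r y : ℝ} (hε : 0 < ε) (hε' : ε < 1 / 4) (hr : 0 < r) (hy : 0 ≤ y)
    (hA0 : 0 < A) (hrδ : r ≤ ε / 100) (hAr : A * r ≤ ε / 100)
    (hA : 176 * exp (25 / 8) / ε ≤ A) : 0 ≤ linOp ε A r y :=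
  (le_total y 5).elim (fun h => linOp_nonneg_of_le_five hε hε' hr hy h hA0 hrδ hAr hA)
    (fun h => linOp_nonneg_of_five_le hε hε' hr h hA0 hrδ hAr)

/-- A second-order upper bound at a zero with unit slope. -/
theorem le_add_sq_of_deriv_two_le {f : ℝ → ℝ} (hf : ContDiff ℝ 2 f) (hf0 : f 0 = 0)
    (hf'0 : deriv f 0 = 1) {K : ℝ} (hK : ∀ u : ℝ, |deriv (deriv f) u| ≤ K) {u : ℝ}
    (hu : 0 ≤ u) : f u ≤ u + K * u ^ 2 := by
  have hd : Differentiable ℝ f := hf.differentiable (by norm_num)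
  have hd' : Differentiable ℝ (deriv f) := by
    have : ContDiff ℝ 1 (deriv f) := by
      have h : ContDiff ℝ (1 + 1) f := by convert hf using 1; norm_num
      exact (contDiff_succ_iff_deriv.mp h).2.2
    exact this.differentiable (by norm_num)
  have h1 : ∀ s, 0 ≤ s → deriv f s ≤ 1 + K * s := by
    intro s hs
    have h := Convex.norm_image_sub_le_of_norm_deriv_le (f := deriv f) (s := univ) (C := K)
      (x := 0) (y := s) (fun x _ => hd' x) (fun x _ => by simpa using hK x) convex_univ
      (mem_univ _) (mem_univ _)
    rw [hf'0, Real.norm_eq_abs, Real.norm_eq_abs, sub_zero, abs_of_nonneg hs] at h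
    linarith [le_abs_self (deriv f s - 1)]
  have hK0 : 0 ≤ K := (abs_nonneg _).trans (hK 0)
  have h := Convex.image_sub_le_mul_sub_of_deriv_le (D := Icc 0 u) (f := f) (C := 1 + K * u)
    (convex_Icc 0 u) hd.continuous.continuousOn hd.differentiableOn
    (fun x hx => by
      rw [interior_Icc] at hx
      have := h1 x hx.1.le
      nlinarith [hx.2])
    0 (left_mem_Icc.mpr hu) u (right_mem_Icc.mpr hu) hu
  rw [hf0] at h
  nlinarith

theorem hasDerivAt_profile_comp {A r y : ℝ → ℝ} {A' r' y' t : ℝ} (hA : HasDerivAt A A' t)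
    (hr : HasDerivAt r r' t) (hy : HasDerivAt y y' t) :
    HasDerivAt (fun s => profile (A s) (r s) (y s))
      (A' * exp (-y t ^ 2 / 4)
        + (2 * A t * A' * r t + A t ^ 2 * r') * ((y t ^ 2 - 2 * y t) * exp (-y t ^ 2 / 4))
        + profileD (A t) (r t) (y t) * y') t := by
  have hg := (hasDerivAt_gauss 4 (y t)).comp t hy
  have hg8 := (hasDerivAt_gauss 8 (y t)).comp t hy
  have hp := ((hy.pow 2).sub (hy.const_mul 2)).mul hg
  have hq := (hasDerivAt_posCube (y t - 1)).comp t (hy.sub_const 1)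
  refine (((hA.mul hg).add (((hA.pow 2).mul hr).mul hp)).add (hq.mul hg8)).congr_deriv ?_
  simp [profileD]; ring

/-- The supersolution in the moving frame. -/
noncomputable def movingSuper (ε t z : ℝ) : ℝ :=
  exp (-z) * profile (t ^ ε) (t ^ (-(1 / 2) : ℝ)) (z * t ^ (-(1 / 2) : ℝ))

theorem hasDerivAt_rpow_div {t : ℝ} (ht : 0 < t) (p : ℝ) :
    HasDerivAt (fun s : ℝ => s ^ p) (p * t ^ p / t) t := by
  refine (Real.hasDerivAt_rpow_const (p := p) (Or.inl ht.ne')).congr_deriv ?_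
  rw [Real.rpow_sub_one ht.ne']; ring

theorem hasDerivAt_movingSuper_time (ε x : ℝ) {t A r y z : ℝ} (ht : 0 < t)
    (hz : z = x - 2 * t + 1 / 2 * Real.log t) (hA : A = t ^ ε)
    (hr : r = t ^ (-(1 / 2) : ℝ)) (hy : y = z * r) :
    HasDerivAt (fun s => movingSuper ε s (x - 2 * s + 1 / 2 * Real.log s))
      (exp (-z) * ((2 - 1 / (2 * t)) * profile A r y + ε * A / t * exp (-y ^ 2 / 4)
        + (2 * ε - 1 / 2) * (A ^ 2 * r) / t * ((y ^ 2 - 2 * y) * exp (-y ^ 2 / 4))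
        + profileD A r y * ((-2 + 1 / (2 * t)) * r - y / (2 * t)))) t := by
  have hz' : HasDerivAt (fun s => x - 2 * s + 1 / 2 * Real.log s) (-2 + 1 / (2 * t)) t := by
    refine ((((hasDerivAt_id t).const_mul 2).const_sub x).add
      ((Real.hasDerivAt_log ht.ne').const_mul (1 / 2))).congr_deriv ?_
    field_simp
  have hr' := hasDerivAt_rpow_div ht (-(1 / 2))
  have h := hz'.neg.exp.mul
    (hasDerivAt_profile_comp (hasDerivAt_rpow_div ht ε) hr' (hz'.mul hr'))
  refine h.congr_deriv ?_
  simp only [Pi.mul_apply, Pi.neg_apply]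
  rw [← hz, ← hr, ← hA, ← hy]
  subst hy
  field_simp
  ring

theorem hasDerivAt_exp_neg_mul_profile (c A r x : ℝ) :
    HasDerivAt (fun x => exp (-(x - c)) * profile A r ((x - c) * r))
      (exp (-(x - c)) * (r * profileD A r ((x - c) * r) - profile A r ((x - c) * r))) x := by
  have hz := (hasDerivAt_id x).sub_const c
  refine (hz.neg.exp.mul ((hasDerivAt_profile A r ((x - c) * r)).comp x
    (hz.mul_const r))).congr_deriv ?_
  simp; ring

theorem hasDerivAt_exp_neg_mul_profileD (c A r x : ℝ) :
    HasDerivAt (fun x => exp (-(x - c)) * profileD A r ((x - c) * r))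
      (exp (-(x - c)) * (r * profileDD A r ((x - c) * r) - profileD A r ((x - c) * r))) x := by
  have hz := (hasDerivAt_id x).sub_const c
  refine (hz.neg.exp.mul ((hasDerivAt_profileD A r ((x - c) * r)).comp x
    (hz.mul_const r))).congr_deriv ?_
  simp; ring

theorem deriv_deriv_exp_neg_mul_profile (a c A r x : ℝ) :
    deriv (deriv fun x => a * (exp (-(x - c)) * profile A r ((x - c) * r))) x =
      a * (exp (-(x - c)) * (r ^ 2 * profileDD A r ((x - c) * r)
        - 2 * r * profileD A r ((x - c) * r) + profile A r ((x - c) * r))) := by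
  have h1 : (deriv fun x => a * (exp (-(x - c)) * profile A r ((x - c) * r))) = fun x =>
      a * (r * (exp (-(x - c)) * profileD A r ((x - c) * r))
        - exp (-(x - c)) * profile A r ((x - c) * r)) := by
    ext x
    rw [((hasDerivAt_exp_neg_mul_profile c A r x).const_mul a).deriv]
    ring
  rw [h1]
  refine ((((hasDerivAt_exp_neg_mul_profileD c A r x).const_mul r).sub
    (hasDerivAt_exp_neg_mul_profile c A r x)).const_mul a).deriv.trans ?_
  ring

/-- The parabolic operator applied to the damped supersolution. -/
theorem damped_movingSuper_residual (ε C x : ℝ) {t A r y z : ℝ} (ht : 0 < t)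
    (hz : z = x - 2 * t + 1 / 2 * Real.log t) (hA : A = t ^ ε)
    (hr : r = t ^ (-(1 / 2) : ℝ)) (hy : y = z * r) {u2 : ℝ → ℝ → ℝ}
    (hu2 : ∀ t x : ℝ, u2 t x =
      (1 - C / t ^ ((1:ℝ)/4)) * movingSuper ε t (x - 2 * t + 1 / 2 * Real.log t)) :
    deriv (fun s => u2 s x) t - deriv (deriv (fun y => u2 t y)) x =
      C / 4 * t ^ (-(5 / 4) : ℝ) * (exp (-z) * profile A r y)
      + (1 - C / t ^ ((1:ℝ)/4)) * exp (-z) * (profile A r y + linOp ε A r y / t) := by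
  have hr2 : r ^ 2 = 1 / t := by
    rw [hr, ← Real.rpow_natCast, ← Real.rpow_mul ht.le]
    norm_num [Real.rpow_neg_one]
  have hdamp : HasDerivAt (fun s : ℝ => 1 - C / s ^ ((1:ℝ)/4)) (C / 4 * t ^ (-(5 / 4) : ℝ)) t := by
    have h := ((hasDerivAt_rpow_div ht (-(1 / 4))).const_mul C).const_sub 1
    have he : (fun s : ℝ => 1 - C / s ^ ((1:ℝ)/4)) =ᶠ[nhds t]
        fun s => 1 - C * s ^ (-(1 / 4) : ℝ) := by
      filter_upwards [Ioi_mem_nhds ht] with s hs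
      rw [Real.rpow_neg (le_of_lt hs)]; rfl
    refine (h.congr_of_eventuallyEq he).congr_deriv ?_
    have : (-(5 / 4) : ℝ) = -(1 / 4) - 1 := by norm_num
    rw [this, Real.rpow_sub_one ht.ne']; ring
  have h1 := (hdamp.mul (hasDerivAt_movingSuper_time ε x ht hz hA hr hy)).deriv
  have h2 := deriv_deriv_exp_neg_mul_profile (1 - C / t ^ ((1:ℝ)/4))
    (2 * t - 1 / 2 * Real.log t) A r x
  have hu2t : (fun s => u2 s x) = (fun s : ℝ => 1 - C / s ^ ((1:ℝ)/4)) *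
      fun s => movingSuper ε s (x - 2 * s + 1 / 2 * Real.log s) := by
    ext s
    exact hu2 s x
  have hu2x : (fun y => u2 t y) = fun x => (1 - C / t ^ ((1:ℝ)/4)) *
        (exp (-(x - (2 * t - 1 / 2 * Real.log t))) *
          profile A r ((x - (2 * t - 1 / 2 * Real.log t)) * r)) := by
    ext x
    rw [hu2, movingSuper, ← hA, ← hr]
    ring_nf
  have hzc : x - (2 * t - 1 / 2 * Real.log t) = z := by rw [hz]; ring
  rw [hu2t, h1, hu2x, h2, hzc, ← hz, ← hy, hr2, linOp, movingSuper, ← hA, ← hr, ← hy]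
  field_simp
  ring

theorem movingSuper_le {ε t z : ℝ} (ht : 0 < t) (hz : 0 ≤ z) (hA : 1 ≤ t ^ ε)
    (hAr : t ^ ε * t ^ (-(1 / 2) : ℝ) ≤ 1) :
    movingSuper ε t z ≤ 133 * t ^ ε * exp (-z) := by
  rw [movingSuper, mul_comm]
  have hr : 0 < t ^ (-(1 / 2) : ℝ) := by positivity
  exact mul_le_mul_of_nonneg_right (profile_le hA hr (by positivity) hAr) (exp_pos _).le

theorem movingSuper_eq_of_le_sqrt {ε t z : ℝ} (ht : 0 < t) (hz : z ≤ Real.sqrt t) :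
    movingSuper ε t z = t ^ ε
      * (1 - 2 * z / t ^ ((1:ℝ) - ε) + z ^ 2 / t ^ ((3:ℝ)/2 - ε))
      * Real.exp (-z) * Real.exp (-z ^ 2 / (4 * t)) := by
  have hr : t ^ (-(1 / 2) : ℝ) = (Real.sqrt t)⁻¹ := by
    rw [Real.rpow_neg ht.le, Real.sqrt_eq_rpow]
  have hs : 0 < Real.sqrt t := Real.sqrt_pos.mpr ht
  have hss : Real.sqrt t ^ 2 = t := Real.sq_sqrt ht.le
  have hq : posCube (z * (Real.sqrt t)⁻¹ - 1) = 0 := by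
    rw [posCube, max_eq_right]
    · norm_num
    · rw [← div_eq_mul_inv, sub_nonpos, div_le_one hs]; exact hz
  have hG : -(z * (Real.sqrt t)⁻¹) ^ 2 / 4 = -z ^ 2 / (4 * t) := by
    rw [mul_pow, inv_pow, hss]; field_simp
  have h1 : t ^ ((1:ℝ) - ε) = Real.sqrt t ^ 2 / t ^ ε := by
    rw [Real.rpow_sub ht, Real.rpow_one, hss]
  have h2 : t ^ ((3:ℝ)/2 - ε) = Real.sqrt t ^ 3 / t ^ ε := by
    rw [Real.rpow_sub ht, Real.sqrt_eq_rpow, ← Real.rpow_natCast (t ^ (1 / 2 : ℝ)),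
      ← Real.rpow_mul ht.le]
    norm_num
  have hA : 0 < t ^ ε := by positivity
  rw [movingSuper, hr, profile, hq, hG, h1, h2]
  field_simp
  ring

theorem eventually_large {ε : ℝ} (hε : 0 < ε) (hε' : ε < 1 / 4) (C : ℝ) :
    ∃ T > (0 : ℝ), ∀ t ≥ T, 1 ≤ t ∧ t ^ (-(1 / 2) : ℝ) ≤ ε / 100 ∧
      t ^ ε * t ^ (-(1 / 2) : ℝ) ≤ ε / 100 ∧ 176 * exp (25 / 8) / ε ≤ t ^ ε ∧
      133 ≤ t ^ (1 / 2 : ℝ) ∧ C ≤ t ^ (1 / 4 : ℝ) ∧ 2 ≤ Real.log t := by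
  have h1 : ∀ᶠ t : ℝ in atTop, t ^ (-(1 / 2) : ℝ) ≤ ε / 100 :=
    (tendsto_rpow_neg_atTop (by norm_num : (0 : ℝ) < 1 / 2)).eventually_le_const (by positivity)
  have h2 : ∀ᶠ t : ℝ in atTop, t ^ (-(1 / 2 - ε)) ≤ ε / 100 :=
    (tendsto_rpow_neg_atTop (by linarith : 0 < 1 / 2 - ε)).eventually_le_const (by positivity)
  have h3 := (tendsto_rpow_atTop hε).eventually_ge_atTop (176 * exp (25 / 8) / ε)
  have h4 := (tendsto_rpow_atTop (by norm_num : (0 : ℝ) < 1 / 2)).eventually_ge_atTop 133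
  have h5 := (tendsto_rpow_atTop (by norm_num : (0 : ℝ) < 1 / 4)).eventually_ge_atTop C
  have h6 := Real.tendsto_log_atTop.eventually_ge_atTop 2
  obtain ⟨T, hT⟩ := eventually_atTop.mp
    ((eventually_ge_atTop (1 : ℝ)).and (h1.and (h2.and (h3.and (h4.and (h5.and h6))))))
  refine ⟨max T 1, by positivity, fun t ht => ?_⟩
  obtain ⟨a, b, c, d⟩ := hT t (le_of_max_le_left ht)
  refine ⟨a, b, ?_, d⟩
  rw [← Real.rpow_add (by linarith)]
  convert c using 2
  ring

/-- Lemma 4.8: the right supersolution in the fast decay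
case: `ū₂(t,x) = (1 − C t^{−1/4}) ũ(t, x − 2t + (1/2) ln t)` is a supersolution
for `t ≥ T`, `x ≥ 2t + ln t − 2`, where `ũ` is explicit for `z ∈ [0,√t]` and
bounded by `t^{2ε+1/2} e^{−z}`. -/
theorem statement_15
    (f : ℝ → ℝ) (hf : ContDiff ℝ 2 f)
    (hf0 : f 0 = 0) (hf1 : f 1 = 0)
    (hf'0 : deriv f 0 = 1) (hf'1 : deriv f 1 < 0)
    (hfpos : ∀ s ∈ Set.Ioo (0:ℝ) 1, 0 < f s)
    (K : ℝ) (hK : ∀ u : ℝ, |deriv (deriv f) u| ≤ K) :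
    ∀ ε ∈ Set.Ioo (0:ℝ) (1/4), ∃ C > (0:ℝ), ∃ T > (0:ℝ), ∃ ut : ℝ → ℝ → ℝ,
      -- `ũ` is positive
      (∀ t ≥ T, ∀ z ≥ (0:ℝ), 0 < ut t z) ∧
      -- (a) supersolution property
      (∀ u2 : ℝ → ℝ → ℝ,
        (∀ t x : ℝ, u2 t x =
          (1 - C / t ^ ((1:ℝ)/4)) * ut t (x - 2 * t + 1 / 2 * Real.log t)) →
        ∀ t ≥ T, ∀ x ≥ 2 * t + Real.log t - 2,
          0 ≤ deriv (fun s => u2 s x) t - deriv (deriv (fun y => u2 t y)) x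
            - f (u2 t x)) ∧
      -- (b) explicit formula for `z ∈ [0,√t]`
      (∀ t ≥ T, ∀ z ∈ Set.Icc (0:ℝ) (Real.sqrt t),
        ut t z = t ^ ε
          * (1 - 2 * z / t ^ ((1:ℝ) - ε) + z ^ 2 / t ^ ((3:ℝ)/2 - ε))
          * Real.exp (-z) * Real.exp (-z ^ 2 / (4 * t))) ∧
      -- (c) upper bound
      (∀ t ≥ T, ∀ z ≥ (0:ℝ),
        ut t z ≤ t ^ (2 * ε + 1/2) * Real.exp (-z)) := by
  rintro ε ⟨hε, hε'⟩
  have hK0 : 0 ≤ K := (abs_nonneg _).trans (hK 0)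
  obtain ⟨T, hT0, hT⟩ := eventually_large hε hε' (4 * K * (133 * exp 2) + 1)
  refine ⟨4 * K * (133 * exp 2) + 1, by positivity, T, hT0, movingSuper ε, ?_, ?_, ?_, ?_⟩
  · intro t ht z hz
    obtain ⟨h1, -, hAr, -⟩ := hT t ht
    have h0 : 0 < t := by linarith
    exact mul_pos (exp_pos _) (profile_pos (by positivity) (by positivity) (by linarith))
  · intro u2 hu2 t ht x hx
    obtain ⟨h1, hr, hAr, hA, -, hC, hlog⟩ := hT t ht
    have h0 : 0 < t := by linarith
    rw [damped_movingSuper_residual ε _ x h0 rfl rfl rfl rfl hu2, hu2]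
    set C := 4 * K * (133 * exp 2) + 1 with hCdef
    have hC0 : 0 < C := by positivity
    set z := x - 2 * t + 1 / 2 * Real.log t with hz
    have hzlog : 3 / 2 * Real.log t - 2 ≤ z := by rw [hz]; linarith
    have hz0 : 0 ≤ z := by linarith
    have hA1 : 1 ≤ t ^ ε := Real.one_le_rpow h1 hε.le
    have ha0 : 0 ≤ 1 - C / t ^ ((1:ℝ)/4) := by
      rw [sub_nonneg, div_le_one (by positivity)]; exact hC
    have ha1 : 1 - C / t ^ ((1:ℝ)/4) ≤ 1 := by
      have : 0 ≤ C / t ^ ((1:ℝ)/4) := by positivity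
      linarith
    have hL := linOp_nonneg (A := t ^ ε) (r := t ^ (-(1 / 2) : ℝ)) (y := z * t ^ (-(1 / 2) : ℝ))
      hε hε' (by positivity) (by positivity) (by positivity) hr hAr hA
    have hU := movingSuper_le h0 hz0 hA1 (by linarith)
    have hU0 : 0 ≤ movingSuper ε t z :=
      (mul_pos (exp_pos _) (profile_pos (by positivity) (by positivity) (by linarith))).le
    have hexp : exp (-z) ≤ exp 2 * t ^ (-(3 / 2) : ℝ) := by
      rw [Real.rpow_def_of_pos h0, ← Real.exp_add]
      apply Real.exp_le_exp.mpr
      linarith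
    have hsmall : movingSuper ε t z ≤ 133 * exp 2 * t ^ (-(5 / 4) : ℝ) :=
      calc movingSuper ε t z ≤ 133 * t ^ ε * exp (-z) := hU
        _ ≤ 133 * t ^ (1 / 4 : ℝ) * (exp 2 * t ^ (-(3 / 2) : ℝ)) := by gcongr
        _ = 133 * exp 2 * (t ^ (1 / 4 : ℝ) * t ^ (-(3 / 2) : ℝ)) := by ring
        _ = 133 * exp 2 * t ^ (-(5 / 4) : ℝ) := by
          rw [← Real.rpow_add h0]; norm_num
    have hfle := le_add_sq_of_deriv_two_le hf hf0 hf'0 hK (mul_nonneg ha0 hU0)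
    have hres : 0 ≤ (1 - C / t ^ ((1:ℝ)/4)) * exp (-z) *
        (linOp ε (t ^ ε) (t ^ (-(1 / 2) : ℝ)) (z * t ^ (-(1 / 2) : ℝ)) / t) :=
      mul_nonneg (mul_nonneg ha0 (exp_pos _).le) (div_nonneg hL h0.le)
    have hsq : K * ((1 - C / t ^ ((1:ℝ)/4)) * movingSuper ε t z) ^ 2 ≤
        C / 4 * t ^ (-(5 / 4) : ℝ) * movingSuper ε t z :=
      calc K * ((1 - C / t ^ ((1:ℝ)/4)) * movingSuper ε t z) ^ 2
          ≤ K * (1 * movingSuper ε t z) ^ 2 := by gcongr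
        _ = K * movingSuper ε t z * movingSuper ε t z := by ring
        _ ≤ K * (133 * exp 2 * t ^ (-(5 / 4) : ℝ)) * movingSuper ε t z := by gcongr
        _ = (C - 1) / 4 * t ^ (-(5 / 4) : ℝ) * movingSuper ε t z := by rw [hCdef]; ring
        _ ≤ C / 4 * t ^ (-(5 / 4) : ℝ) * movingSuper ε t z := by gcongr; linarith
    rw [movingSuper] at hfle hsq ⊢
    linarith
  · intro t ht z hz
    exact movingSuper_eq_of_le_sqrt (by linarith) hz.2
  · intro t ht z hz
    obtain ⟨h1, -, hAr, -, hs, -⟩ := hT t ht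
    have h0 : 0 < t := by linarith
    have hA1 : 1 ≤ t ^ ε := Real.one_le_rpow h1 hε.le
    refine (movingSuper_le h0 hz hA1 (by linarith)).trans ?_
    refine mul_le_mul_of_nonneg_right ?_ (exp_pos _).le
    rw [Real.rpow_add h0, two_mul, Real.rpow_add h0, mul_comm]
    refine mul_le_mul ?_ hs (by norm_num) (by positivity)
    exact le_mul_of_one_le_left (by positivity) hA1
end
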